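/- Let p, q be probability vectors on Fin d. Then the following are equivalent: (1) for every ε > 0 there exists a probability vector p' on Fin d with ∑ i, |p' i − p i| < ε, and there exist m ≥ 1 and a probability vector r on Fin m such that p' ⊗ r ≺ q ⊗ r; (2) all of the following hold: (i) for every α with 0 < α < 1, A_α(p) ≥ A_α(q); (ii) ∏ i, p i ≥ ∏ i, q i; (iii) for every α < 0, A_α(p) ≥ A_α(q), where A_α(x) is taken to be 0 when α < 0 and some entry of x is zero; (iv) for every α > 1, A_α(p) ≤ A_α(q); (v) H(p) ≥ H(q). -/

import Mathlib

open Finset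

/-- max over finsets of card k of the sum of entries -/
noncomputable def maxSum {ι : Type*} [Fintype ι] (p : ι → ℝ) (k : ℕ) : ℝ :=
  sSup {x : ℝ | ∃ S : Finset ι, S.card = k ∧ x = ∑ i ∈ S, p i}

/-- majorization: equal total sums, and for each k the max k-term partial sum
of `p` is at most that of `q`. -/
def Maj {ι : Type*} [Fintype ι] (p q : ι → ℝ) : Prop :=
  (∑ i, p i = ∑ i, q i) ∧ ∀ k : ℕ, maxSum p k ≤ maxSum q k

/-- a probability vector: nonnegative entries summing to one -/
def IsProbVec {ι : Type*} [Fintype ι] (p : ι → ℝ) : Prop :=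
  (∀ i, 0 ≤ p i) ∧ ∑ i, p i = 1

/-- tensor product of two vectors -/
def tensor {ι κ : Type*} (p : ι → ℝ) (r : κ → ℝ) : ι × κ → ℝ :=
  fun x => p x.1 * r x.2

/-- Shannon entropy (with `0 * log 0 = 0` automatic since `Real.log 0 = 0`) -/
noncomputable def shannon {ι : Type*} [Fintype ι] (p : ι → ℝ) : ℝ :=
  -∑ i, p i * Real.log (p i)

/-- `A_α(p) = ((1/d) ∑ i, (p i)^α)^(1/α)`, with the convention that it is `0`
when `α < 0` and some entry of `p` vanishes. -/
noncomputable def Aalpha (d : ℕ) (α : ℝ) (p : Fin d → ℝ) : ℝ :=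
  if α < 0 ∧ ∃ i, p i = 0 then 0
  else ((1 / (d : ℝ)) * ∑ i, (p i) ^ α) ^ (1 / α)

section Majorization

variable {ι : Type*} [Fintype ι]

lemma finite_cardSums (x : ι → ℝ) (k : ℕ) :
    {a : ℝ | ∃ S : Finset ι, S.card = k ∧ a = ∑ i ∈ S, x i}.Finite := by
  refine (Set.finite_range fun S : Finset ι => ∑ i ∈ S, x i).subset ?_
  rintro a ⟨S, -, rfl⟩
  exact ⟨S, rfl⟩

lemma sum_le_maxSum (x : ι → ℝ) (S : Finset ι) : ∑ i ∈ S, x i ≤ maxSum x S.card :=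
  le_csSup (finite_cardSums x S.card).bddAbove ⟨S, rfl, rfl⟩

lemma maxSum_le {x : ι → ℝ} {k : ℕ} {b : ℝ} (hk : k ≤ Fintype.card ι)
    (h : ∀ S : Finset ι, S.card = k → ∑ i ∈ S, x i ≤ b) : maxSum x k ≤ b := by
  obtain ⟨S, -, hS⟩ := Finset.exists_subset_card_eq (s := (univ : Finset ι)) (n := k) (by simpa)
  refine csSup_le ⟨_, S, hS, rfl⟩ ?_
  rintro a ⟨S, hS, rfl⟩
  exact h S hS

lemma exists_sum_eq_maxSum (x : ι → ℝ) {k : ℕ} (hk : k ≤ Fintype.card ι) :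
    ∃ S : Finset ι, S.card = k ∧ ∑ i ∈ S, x i = maxSum x k := by
  obtain ⟨S, -, hS⟩ := Finset.exists_subset_card_eq (s := (univ : Finset ι)) (n := k) (by simpa)
  obtain ⟨T, hT, h⟩ := Set.Nonempty.csSup_mem
    (s := {a : ℝ | ∃ S : Finset ι, S.card = k ∧ a = ∑ i ∈ S, x i}) ⟨_, S, hS, rfl⟩
    (finite_cardSums x k)
  exact ⟨T, hT, h.symm⟩

lemma maxSum_of_card_lt (x : ι → ℝ) {k : ℕ} (hk : Fintype.card ι < k) : maxSum x k = 0 := by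
  have : {a : ℝ | ∃ S : Finset ι, S.card = k ∧ a = ∑ i ∈ S, x i} = ∅ := by
    ext a
    simp only [Set.mem_ofPred_eq, Set.mem_empty_iff_false, iff_false]
    rintro ⟨S, rfl, -⟩
    exact absurd (Finset.card_le_univ S) (by omega)
  rw [maxSum, this, Real.sSup_empty]

lemma sum_sub_le_sum_hinge (y : ι → ℝ) (S : Finset ι) (t : ℝ) :
    ∑ i ∈ S, y i - S.card * t ≤ ∑ i, max (y i - t) 0 := by
  calc ∑ i ∈ S, y i - S.card * t = ∑ i ∈ S, (y i - t) := by simp [Finset.sum_sub_distrib]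
    _ ≤ ∑ i ∈ S, max (y i - t) 0 := Finset.sum_le_sum fun i _ => le_max_left _ _
    _ ≤ _ := Finset.sum_le_sum_of_subset_of_nonneg (Finset.subset_univ _)
        fun i _ _ => le_max_right _ _

/-- A maximizing set of `k ≥ 1` indices is cut out by a threshold. -/
lemma exists_threshold (y : ι → ℝ) {k : ℕ} (hk0 : k ≠ 0) (hk : k ≤ Fintype.card ι) :
    ∃ t : ℝ, ∑ i, max (y i - t) 0 = maxSum y k - k * t := by
  classical
  obtain ⟨S, hS, hmax⟩ := exists_sum_eq_maxSum y hk
  have hne : S.Nonempty := by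
    rw [← Finset.card_pos]; omega
  obtain ⟨i₀, hi₀, hmin⟩ := S.exists_min_image y hne
  refine ⟨y i₀, ?_⟩
  have hout : ∀ j ∉ S, y j ≤ y i₀ := by
    intro j hj
    have hj' : j ∉ S.erase i₀ := fun h => hj (Finset.mem_of_mem_erase h)
    have hcard : (insert j (S.erase i₀)).card = k := by
      rw [Finset.card_insert_of_notMem hj', Finset.card_erase_of_mem hi₀]
      omega
    have h := sum_le_maxSum y (insert j (S.erase i₀))
    rw [hcard, ← hmax, Finset.sum_insert hj', ← Finset.add_sum_erase S y hi₀] at h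
    linarith
  rw [← Finset.sum_subset (Finset.subset_univ S), ← hmax, ← hS]
  · rw [Finset.sum_congr rfl fun i hi => max_eq_left (sub_nonneg.2 (hmin i hi))]
    simp [Finset.sum_sub_distrib]
  · intro j _ hj
    exact max_eq_right (sub_nonpos.2 (hout j hj))

lemma Maj.hinge_le {x y : ι → ℝ} (h : Maj x y) (t : ℝ) :
    ∑ i, max (x i - t) 0 ≤ ∑ i, max (y i - t) 0 := by
  classical
  have hx : ∑ i, max (x i - t) 0 =
      ∑ i with t < x i, x i - (univ.filter fun i => t < x i).card * t := by
    rw [← nsmul_eq_mul, ← Finset.sum_const, ← Finset.sum_sub_distrib, Finset.sum_filter]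
    refine Finset.sum_congr rfl fun i _ => ?_
    split_ifs with hi
    · exact max_eq_left (by linarith)
    · exact max_eq_right (by linarith)
  set k := (univ.filter fun i => t < x i).card with hk
  obtain ⟨S, hS, hmax⟩ := exists_sum_eq_maxSum y (k := k) (Finset.card_le_univ _)
  have h1 := sum_le_maxSum x (univ.filter fun i => t < x i)
  have h2 := sum_sub_le_sum_hinge y S t
  have h3 := h.2 k
  rw [hS] at h2
  rw [hx]
  linarith

lemma maj_of_hinge_le {x y : ι → ℝ} (hsum : ∑ i, x i = ∑ i, y i)
    (h : ∀ t, ∑ i, max (x i - t) 0 ≤ ∑ i, max (y i - t) 0) : Maj x y := by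
  refine ⟨hsum, fun k => ?_⟩
  rcases lt_or_ge (Fintype.card ι) k with hk | hk
  · rw [maxSum_of_card_lt x hk, maxSum_of_card_lt y hk]
  rcases eq_or_ne k 0 with rfl | hk0
  · refine maxSum_le hk fun S hS => ?_
    have := sum_le_maxSum y ∅
    simp_all
  obtain ⟨t, ht⟩ := exists_threshold y hk0 hk
  refine maxSum_le hk fun S hS => ?_
  have h1 := sum_sub_le_sum_hinge x S t
  have h2 := h t
  rw [hS] at h1
  linarith

lemma exists_hinge_interpolation {φ : ℝ → ℝ} {I : Set ℝ} (hφ : ConvexOn ℝ I φ)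
    {T : (ℝ → ℝ) → Prop} (haff : ∀ a b : ℝ, T fun z => a + b * z)
    (hadd : ∀ ψ : ℝ → ℝ, ∀ c t : ℝ, 0 ≤ c → T ψ → T fun z => ψ z + c * max (z - t) 0)
    (Z : Finset ℝ) : (∀ z ∈ Z, z ∈ I) → ∀ w ∈ I, (∀ z ∈ Z, z < w) → ∃ ψ, T ψ ∧
      (∀ z ∈ insert w Z, ψ z = φ z) ∧
      ∀ M ∈ Z, (∀ z ∈ Z, z ≤ M) → ∀ v, M ≤ v → ψ v = φ M + (φ w - φ M) / (w - M) * (v - M) := by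
  induction Z using Finset.induction_on_max with
  | empty =>
    intro _ w _ _
    refine ⟨fun z => φ w + 0 * z, haff _ _, by simp, by simp⟩
  | insert a Z ha ih =>
    intro hZ w hw hlt
    have haI : a ∈ I := hZ a (by simp)
    have haw : a < w := hlt a (by simp)
    rcases Z.eq_empty_or_nonempty with rfl | hne
    · refine ⟨fun z => (φ a - (φ w - φ a) / (w - a) * a) + (φ w - φ a) / (w - a) * z,
        haff _ _, ?_, ?_⟩
      · have : w - a ≠ 0 := by linarith
        simp only [insert_empty_eq, mem_insert, mem_singleton, forall_eq_or_imp, forall_eq]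
        constructor
        · field_simp; ring
        · ring
      · intro M hM _ v _
        obtain rfl : M = a := by simpa using hM
        ring
    · obtain ⟨ψ, hT, heq, hlin⟩ := ih (fun z hz => hZ z (by simp [hz])) a haI ha
      set M := Z.max' hne with hM
      have hMZ : M ∈ Z := Z.max'_mem hne
      have hMa : M < a := ha M hMZ
      have hlin' := hlin M hMZ (fun z hz => Z.le_max' z hz)
      have hslope := hφ.slope_mono_adjacent (hZ M (by simp [hMZ])) hw hMa haw
      set s₁ := (φ a - φ M) / (a - M) with hs₁
      set s₂ := (φ w - φ a) / (w - a) with hs₂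
      have e₁ : s₁ * (a - M) = φ a - φ M := div_mul_cancel₀ _ (by linarith)
      have e₂ : s₂ * (w - a) = φ w - φ a := div_mul_cancel₀ _ (by linarith)
      have hafter : ∀ v, a ≤ v →
          ψ v + (s₂ - s₁) * max (v - a) 0 = φ a + s₂ * (v - a) := by
        intro v hv
        rw [hlin' v (by linarith), max_eq_left (by linarith)]
        linear_combination e₁
      refine ⟨_, hadd ψ (s₂ - s₁) a (by linarith) hT, ?_, ?_⟩
      · intro z hz
        rcases Finset.mem_insert.1 hz with rfl | hz
        · rw [hafter z haw.le]
          linear_combination e₂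
        · have hza : z ≤ a := by
            rcases Finset.mem_insert.1 hz with rfl | hz
            · exact le_rfl
            · exact (ha z hz).le
          change ψ z + (s₂ - s₁) * max (z - a) 0 = φ z
          rw [max_eq_right (by linarith), heq z hz]
          ring
      · intro M' hM' hmax v hv
        obtain rfl : M' = a := by
          rcases Finset.mem_insert.1 hM' with h | h
          · exact h
          · exact absurd (hmax a (by simp)) (not_le.2 (ha M' h))
        exact hafter v hv

/-- Karamata's inequality, with majorization expressed through hinge functions. -/
lemma sum_convex_le_of_hinge_le {γ : Type*} {s : Finset γ} {x y : γ → ℝ} {φ : ℝ → ℝ} {I : Set ℝ}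
    (hφ : ConvexOn ℝ I φ) (hx : ∀ i ∈ s, x i ∈ I) (hy : ∀ i ∈ s, y i ∈ I)
    (hsum : ∑ i ∈ s, x i = ∑ i ∈ s, y i)
    (h : ∀ t, ∑ i ∈ s, max (x i - t) 0 ≤ ∑ i ∈ s, max (y i - t) 0) :
    ∑ i ∈ s, φ (x i) ≤ ∑ i ∈ s, φ (y i) := by
  classical
  set V : Finset ℝ := s.image x ∪ s.image y with hV
  have hVI : ∀ z ∈ V, z ∈ I := by
    intro z hz
    simp only [hV, mem_union, mem_image] at hz
    rcases hz with ⟨i, hi, rfl⟩ | ⟨i, hi, rfl⟩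
    exacts [hx i hi, hy i hi]
  rcases V.eq_empty_or_nonempty with hempty | hne
  · have : s = ∅ := by
      simpa [hV, Finset.union_eq_empty] using hempty
    simp [this]
  obtain ⟨ψ, hT, heq, -⟩ := exists_hinge_interpolation hφ
    (T := fun ψ => ∑ i ∈ s, ψ (x i) ≤ ∑ i ∈ s, ψ (y i))
    (fun a b => by simp [Finset.sum_add_distrib, ← Finset.mul_sum, hsum])
    (fun ψ c t hc hψ => by
      simp only [Finset.sum_add_distrib, ← Finset.mul_sum]
      exact add_le_add hψ (mul_le_mul_of_nonneg_left (h t) hc))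
    (V.erase (V.max' hne)) (fun z hz => hVI z (Finset.mem_of_mem_erase hz)) (V.max' hne)
    (hVI _ (V.max'_mem hne))
    (fun z hz => lt_of_le_of_ne (V.le_max' z (Finset.mem_of_mem_erase hz))
      (Finset.ne_of_mem_erase hz))
  rw [Finset.insert_erase (V.max'_mem hne)] at heq
  have hxV : ∀ i ∈ s, x i ∈ V := fun i hi =>
    Finset.mem_union_left _ (Finset.mem_image_of_mem x hi)
  have hyV : ∀ i ∈ s, y i ∈ V := fun i hi =>
    Finset.mem_union_right _ (Finset.mem_image_of_mem y hi)
  rwa [Finset.sum_congr rfl fun i hi => heq (x i) (hxV i hi),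
    Finset.sum_congr rfl fun i hi => heq (y i) (hyV i hi)] at hT

end Majorization

/-- The Rényi-type inequalities expected of `x` when it is obtained from `y` by majorization
assisted by a catalyst, written with plain power sums. -/
structure RenyiLE {ι : Type*} [Fintype ι] (x y : ι → ℝ) : Prop where
  one_lt : ∀ α : ℝ, 1 < α → ∑ i, x i ^ α ≤ ∑ i, y i ^ α
  lt_one : ∀ α : ℝ, 0 < α → α < 1 → ∑ i, y i ^ α ≤ ∑ i, x i ^ α
  entropy : ∑ i, x i * Real.log (x i) ≤ ∑ i, y i * Real.log (y i)
  pos : (∀ i, 0 < y i) → ∀ i, 0 < x i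
  neg : (∀ i, 0 < y i) → ∀ α : ℝ, α < 0 → ∑ i, x i ^ α ≤ ∑ i, y i ^ α
  log : (∀ i, 0 < y i) → ∑ i, Real.log (y i) ≤ ∑ i, Real.log (x i)

section Power

open Real

lemma strictConvexOn_rpow_of_neg {α : ℝ} (hα : α < 0) :
    StrictConvexOn ℝ (Set.Ioi 0) fun x : ℝ => x ^ α := by
  refine strictConvexOn_of_deriv2_pos (convex_Ioi 0) ?_ ?_
  · exact fun x hx => (continuousAt_rpow_const x α (Or.inl (ne_of_gt hx))).continuousWithinAt
  · intro x hx
    rw [interior_Ioi] at hx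
    have hx0 : (0 : ℝ) < x := hx
    have h1 : deriv^[2] (fun x : ℝ => x ^ α) x = α * ((α - 1) * x ^ (α - 2)) := by
      have : deriv (fun x : ℝ => x ^ α) =ᶠ[nhds x] fun x => α * x ^ (α - 1) := by
        filter_upwards [lt_mem_nhds hx0] with z hz
        exact (hasDerivAt_rpow_const (Or.inl (ne_of_gt hz))).deriv
      rw [Function.iterate_succ, Function.iterate_one, Function.comp_apply, this.deriv_eq]
      have h := ((hasDerivAt_rpow_const (p := α - 1) (Or.inl (ne_of_gt hx0))).const_mul α).deriv
      rw [h]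
      congr 3
      ring
    rw [h1]
    have := rpow_pos_of_pos hx0 (α - 2)
    have h2 : 0 < α * (α - 1) := mul_pos_of_neg_of_neg hα (by linarith)
    rw [← mul_assoc]
    exact mul_pos h2 this

variable {ι κ : Type*} [Fintype ι] [Fintype κ] {x y : ι → ℝ} {r : κ → ℝ}

lemma sum_tensor (x : ι → ℝ) (r : κ → ℝ) (φ : ℝ → ℝ) :
    ∑ z, φ (tensor x r z) = ∑ j, ∑ i, φ (x i * r j) := by
  rw [Fintype.sum_prod_type, Finset.sum_comm]
  rfl

lemma sum_tensor_rpow (hx : ∀ i, 0 ≤ x i) (hr : ∀ j, 0 ≤ r j) (α : ℝ) :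
    ∑ z, tensor x r z ^ α = (∑ i, x i ^ α) * ∑ j, r j ^ α := by
  rw [Finset.sum_mul_sum, Fintype.sum_prod_type]
  exact Finset.sum_congr rfl fun i _ => Finset.sum_congr rfl fun j _ =>
    mul_rpow (hx i) (hr j)

lemma sum_rpow_pos (hr : IsProbVec r) (α : ℝ) : 0 < ∑ j, r j ^ α := by
  refine Finset.sum_pos' (fun j _ => rpow_nonneg (hr.1 j) α) ?_
  by_contra! h
  have : ∀ j, r j = 0 := by
    intro j
    by_contra hj
    exact absurd (h j (mem_univ j)) (not_le.2 (rpow_pos_of_pos (lt_of_le_of_ne (hr.1 j)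
      (Ne.symm hj)) α))
  have h1 := hr.2
  simp [this] at h1

lemma tensor_nonneg {ι κ : Type*} {x : ι → ℝ} {r : κ → ℝ} (hx : ∀ i, 0 ≤ x i)
    (hr : ∀ j, 0 ≤ r j) (z : ι × κ) : 0 ≤ tensor x r z :=
  mul_nonneg (hx _) (hr _)

lemma sum_tensor_mul_log (hx : IsProbVec x) (hr : IsProbVec r) :
    ∑ z, tensor x r z * log (tensor x r z) =
      ∑ i, x i * log (x i) + ∑ j, r j * log (r j) := by
  have h : ∀ i j, x i * r j * log (x i * r j) =
      r j * (x i * log (x i)) + x i * (r j * log (r j)) := by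
    intro i j
    have := negMulLog_mul (x i) (r j)
    simp only [negMulLog] at this
    linarith
  rw [Fintype.sum_prod_type]
  simp only [tensor, h, Finset.sum_add_distrib, ← Finset.mul_sum, ← Finset.sum_mul, hr.2, hx.2,
    one_mul]

/-- On the support of the catalyst, majorization still yields the hinge inequalities. -/
lemma Maj.hinge_le_support (hmaj : Maj (tensor x r) (tensor y r)) (t : ℝ) :
    ∑ j with r j ≠ 0, ∑ i, max (x i * r j - t) 0 ≤
      ∑ j with r j ≠ 0, ∑ i, max (y i * r j - t) 0 := by
  have h := hmaj.hinge_le t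
  rw [sum_tensor x r fun z => max (z - t) 0, sum_tensor y r fun z => max (z - t) 0,
    ← Finset.sum_filter_add_sum_filter_not univ (fun j => r j ≠ 0),
    ← Finset.sum_filter_add_sum_filter_not univ (fun j => r j ≠ 0) (fun j => ∑ i,
      max (y i * r j - t) 0)] at h
  have e : ∑ j with ¬ r j ≠ 0, ∑ i, max (x i * r j - t) 0 =
      ∑ j with ¬ r j ≠ 0, ∑ i, max (y i * r j - t) 0 := by
    refine Finset.sum_congr rfl fun j hj => ?_
    have : r j = 0 := by simpa using hj
    simp [this]
  linarith

lemma Maj.sum_support_le (hmaj : Maj (tensor x r) (tensor y r)) {φ : ℝ → ℝ} {I : Set ℝ}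
    (hφ : ConvexOn ℝ I φ) (hsum : ∑ i, x i = ∑ i, y i)
    (hx : ∀ i j, r j ≠ 0 → x i * r j ∈ I) (hy : ∀ i j, r j ≠ 0 → y i * r j ∈ I) :
    ∑ j with r j ≠ 0, ∑ i, φ (x i * r j) ≤ ∑ j with r j ≠ 0, ∑ i, φ (y i * r j) := by
  have key := sum_convex_le_of_hinge_le (s := (univ.filter fun j => r j ≠ 0) ×ˢ (univ : Finset ι))
    (x := fun z => x z.2 * r z.1) (y := fun z => y z.2 * r z.1) hφ
    (fun z hz => hx _ _ (by simpa using hz)) (fun z hz => hy _ _ (by simpa using hz))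
    (by simp only [Finset.sum_product, ← Finset.sum_mul, hsum])
    (fun t => by simpa only [Finset.sum_product] using hmaj.hinge_le_support t)
  simpa only [Finset.sum_product] using key

lemma Maj.pos_of_pos (hr : IsProbVec r) (hmaj : Maj (tensor x r) (tensor y r))
    (hsum : ∑ i, x i = ∑ i, y i) (hx : ∀ i, 0 ≤ x i) (hy : ∀ i, 0 < y i) (i : ι) : 0 < x i := by
  classical
  set S := univ.filter fun j => r j ≠ 0 with hS
  have hrpos : ∀ j ∈ S, 0 < r j := fun j hj =>
    lt_of_le_of_ne (hr.1 j) (Ne.symm (by simpa [hS] using hj))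
  have hSne : S.Nonempty := by
    rw [Finset.nonempty_iff_ne_empty]
    intro h
    have h0 : ∀ j, r j = 0 := by
      simpa [hS, Finset.filter_eq_empty_iff] using h
    have h1 := hr.2
    simp [h0] at h1
  obtain ⟨i₀, -, hi₀⟩ := Finset.exists_min_image univ y ⟨i, mem_univ i⟩
  obtain ⟨j₀, hj₀, hj₀'⟩ := S.exists_min_image r hSne
  by_contra hxi
  have hxi0 : x i = 0 := le_antisymm (not_lt.1 hxi) (hx i)
  have ht : 0 < y i₀ * r j₀ := mul_pos (hy i₀) (hrpos j₀ hj₀)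
  set t := y i₀ * r j₀ with htdef
  have h := hmaj.hinge_le_support t
  rw [← hS] at h
  have hR : ∑ j ∈ S, ∑ i, max (y i * r j - t) 0 = ∑ j ∈ S, ∑ i, (y i * r j - t) := by
    refine Finset.sum_congr rfl fun j hj => Finset.sum_congr rfl fun i _ => ?_
    refine max_eq_left (sub_nonneg.2 ?_)
    exact mul_le_mul (hi₀ i (mem_univ i)) (hj₀' j hj) (hrpos j₀ hj₀).le (hy i).le
  have hL : ∑ j ∈ S, ∑ i, (x i * r j - t) < ∑ j ∈ S, ∑ i, max (x i * r j - t) 0 := by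
    refine Finset.sum_lt_sum (fun j _ => Finset.sum_le_sum fun i _ => le_max_left _ _)
      ⟨j₀, hj₀, Finset.sum_lt_sum (fun i _ => le_max_left _ _) ⟨i, mem_univ i, ?_⟩⟩
    refine lt_of_lt_of_le ?_ (le_max_right _ _)
    rw [hxi0]
    linarith
  have e : ∑ j ∈ S, ∑ i, (x i * r j - t) = ∑ j ∈ S, ∑ i, (y i * r j - t) := by
    simp only [Finset.sum_sub_distrib, ← Finset.sum_mul, hsum]
  linarith

lemma Maj.renyiLE (hx : IsProbVec x) (hy : IsProbVec y) (hr : IsProbVec r)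
    (hmaj : Maj (tensor x r) (tensor y r)) : RenyiLE x y := by
  have hsum : ∑ i, x i = ∑ i, y i := hx.2.trans hy.2.symm
  have full : ∀ φ : ℝ → ℝ, ConvexOn ℝ (Set.Ici 0) φ →
      ∑ z, φ (tensor x r z) ≤ ∑ z, φ (tensor y r z) := fun φ hφ =>
    sum_convex_le_of_hinge_le hφ (fun z _ => tensor_nonneg hx.1 hr.1 z)
      (fun z _ => tensor_nonneg hy.1 hr.1 z) hmaj.1 hmaj.hinge_le
  have hpos : (∀ i, 0 < y i) → ∀ i, 0 < x i := hmaj.pos_of_pos hr hsum hx.1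
  have hrpos : ∀ j, r j ≠ 0 → 0 < r j := fun j hj => lt_of_le_of_ne (hr.1 j) (Ne.symm hj)
  have supp : ∀ φ : ℝ → ℝ, ConvexOn ℝ (Set.Ioi 0) φ → (∀ i, 0 < y i) →
      ∑ j with r j ≠ 0, ∑ i, φ (x i * r j) ≤ ∑ j with r j ≠ 0, ∑ i, φ (y i * r j) :=
    fun φ hφ hy0 => hmaj.sum_support_le hφ hsum
      (fun i j hj => mul_pos (hpos hy0 i) (hrpos j hj)) (fun i j hj => mul_pos (hy0 i) (hrpos j hj))
  have hne : (univ.filter fun j => r j ≠ 0).Nonempty := by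
    rw [Finset.nonempty_iff_ne_empty]
    intro h
    have h0 : ∀ j, r j = 0 := by
      simpa [Finset.filter_eq_empty_iff] using h
    have h1 := hr.2
    simp [h0] at h1
  refine ⟨fun α hα => ?_, fun α h0 h1 => ?_, ?_, hpos, fun hy0 α hα => ?_, fun hy0 => ?_⟩
  · have h := full _ (convexOn_rpow hα.le)
    rw [sum_tensor_rpow hx.1 hr.1, sum_tensor_rpow hy.1 hr.1] at h
    exact le_of_mul_le_mul_right h (sum_rpow_pos hr α)
  · have h := full _ (strictConcaveOn_rpow h0 h1).concaveOn.neg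
    simp only [Pi.neg_apply, Finset.sum_neg_distrib, neg_le_neg_iff] at h
    rw [sum_tensor_rpow hx.1 hr.1, sum_tensor_rpow hy.1 hr.1] at h
    exact le_of_mul_le_mul_right h (sum_rpow_pos hr α)
  · have h := full _ strictConvexOn_mul_log.convexOn
    rw [sum_tensor_mul_log hx hr, sum_tensor_mul_log hy hr] at h
    linarith
  · have h := supp _ (strictConvexOn_rpow_of_neg hα).convexOn hy0
    simp only [mul_rpow (hx.1 _) (hr.1 _), mul_rpow (hy.1 _) (hr.1 _), ← Finset.sum_mul,
      ← Finset.mul_sum] at h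
    refine le_of_mul_le_mul_right h (Finset.sum_pos (fun j hj => ?_) hne)
    exact rpow_pos_of_pos (hrpos j (by simpa using hj)) α
  · have h := supp _ strictConcaveOn_log_Ioi.concaveOn.neg hy0
    have e : ∀ v : ι → ℝ, (∀ i, 0 < v i) → ∑ j with r j ≠ 0, ∑ i, (-log) (v i * r j) =
        ∑ j with r j ≠ 0, (-(∑ i, log (v i)) - Fintype.card ι * log (r j)) := by
      intro v hv
      refine Finset.sum_congr rfl fun j hj => ?_
      have hj : r j ≠ 0 := by simpa using hj
      simp only [Pi.neg_apply, log_mul (hv _).ne' hj, neg_add, Finset.sum_add_distrib,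
        Finset.sum_neg_distrib, Finset.sum_const, Finset.card_univ, nsmul_eq_mul]
      ring
    rw [e x (hpos hy0), e y hy0, Finset.sum_sub_distrib, Finset.sum_sub_distrib,
      Finset.sum_const, Finset.sum_const, nsmul_eq_mul, nsmul_eq_mul] at h
    have hc : (0 : ℝ) < (univ.filter fun j => r j ≠ 0).card := by
      exact_mod_cast Finset.card_pos.2 hne
    have := le_of_mul_le_mul_left (sub_le_sub_iff_right _ |>.1 h) hc
    linarith

/-- The Rényi inequalities pass to the limit in the first argument. -/
lemma RenyiLE.of_tendsto {u : ℕ → ι → ℝ} (hu : ∀ n, RenyiLE (u n) y)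
    (hlim : Filter.Tendsto u Filter.atTop (nhds x)) : RenyiLE x y := by
  have hi : ∀ i, Filter.Tendsto (fun n => u n i) Filter.atTop (nhds (x i)) :=
    fun i => (continuous_apply i).continuousAt.tendsto.comp hlim
  have hpos : (∀ i, 0 < y i) → ∀ i, 0 < x i := by
    intro hy0 i
    have hB : 0 < ∑ j, y j ^ (-1 : ℝ) :=
      Finset.sum_pos (fun j _ => rpow_pos_of_pos (hy0 j) _) ⟨i, mem_univ i⟩
    refine lt_of_lt_of_le (inv_pos.2 hB) (ge_of_tendsto' (hi i) fun n => ?_)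
    have h1 := (hu n).pos hy0
    have h2 : u n i ^ (-1 : ℝ) ≤ ∑ j, y j ^ (-1 : ℝ) :=
      (Finset.single_le_sum (f := fun i => u n i ^ (-1 : ℝ))
        (fun j _ => rpow_nonneg (h1 j).le _) (mem_univ i)).trans ((hu n).neg hy0 _ (by norm_num))
    rw [rpow_neg_one] at h2
    exact (inv_le_comm₀ (h1 i) hB).1 h2
  refine ⟨fun α hα => ?_, fun α h0 h1 => ?_, ?_, hpos, fun hy0 α hα => ?_, fun hy0 => ?_⟩
  · have ht : Filter.Tendsto (fun n => ∑ i, u n i ^ α) Filter.atTop (nhds (∑ i, x i ^ α)) :=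
      tendsto_finsetSum _ fun i _ => (hi i).rpow_const (Or.inr (by linarith))
    exact le_of_tendsto' ht fun n => (hu n).one_lt α hα
  · have ht : Filter.Tendsto (fun n => ∑ i, u n i ^ α) Filter.atTop (nhds (∑ i, x i ^ α)) :=
      tendsto_finsetSum _ fun i _ => (hi i).rpow_const (Or.inr h0.le)
    exact ge_of_tendsto' ht fun n => (hu n).lt_one α h0 h1
  · have ht : Filter.Tendsto (fun n => ∑ i, u n i * Real.log (u n i)) Filter.atTop
        (nhds (∑ i, x i * Real.log (x i))) :=
      tendsto_finsetSum _ fun i _ => (continuous_mul_log.tendsto (x i)).comp (hi i)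
    exact le_of_tendsto' ht fun n => (hu n).entropy
  · have ht : Filter.Tendsto (fun n => ∑ i, u n i ^ α) Filter.atTop (nhds (∑ i, x i ^ α)) :=
      tendsto_finsetSum _ fun i _ => (hi i).rpow_const (Or.inl (hpos hy0 i).ne')
    exact le_of_tendsto' ht fun n => (hu n).neg hy0 α hα
  · have ht : Filter.Tendsto (fun n => ∑ i, Real.log (u n i)) Filter.atTop
        (nhds (∑ i, Real.log (x i))) :=
      tendsto_finsetSum _ fun i _ => (hi i).log (hpos hy0 i).ne'
    exact ge_of_tendsto' ht fun n => (hu n).log hy0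

lemma renyiLE_iff {d : ℕ} {p q : Fin d → ℝ} (hp : IsProbVec p) (hq : IsProbVec q) :
    RenyiLE p q ↔ ((∀ α : ℝ, 0 < α → α < 1 → Aalpha d α q ≤ Aalpha d α p) ∧
       (∏ i, q i ≤ ∏ i, p i) ∧
       (∀ α : ℝ, α < 0 → Aalpha d α q ≤ Aalpha d α p) ∧
       (∀ α : ℝ, 1 < α → Aalpha d α p ≤ Aalpha d α q) ∧
       shannon q ≤ shannon p) := by
  have hd : (0 : ℝ) < 1 / d := by
    rcases Nat.eq_zero_or_pos d with rfl | h
    · have := hp.2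
      simp at this
    · positivity
  have hpow : ∀ x : Fin d → ℝ, (∀ i, 0 ≤ x i) → ∀ α : ℝ, 0 ≤ 1 / (d : ℝ) * ∑ i, x i ^ α :=
    fun x hx α => mul_nonneg hd.le (Finset.sum_nonneg fun i _ => rpow_nonneg (hx i) α)
  have hAnn : ∀ x : Fin d → ℝ, (∀ i, 0 ≤ x i) → ∀ α : ℝ, 0 ≤ Aalpha d α x := by
    intro x hx α
    unfold Aalpha
    split_ifs
    exacts [le_rfl, rpow_nonneg (hpow x hx α) _]
  have hApos : ∀ x y : Fin d → ℝ, (∀ i, 0 ≤ x i) → (∀ i, 0 ≤ y i) → ∀ α : ℝ, 0 < α →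
      (Aalpha d α x ≤ Aalpha d α y ↔ ∑ i, x i ^ α ≤ ∑ i, y i ^ α) := by
    intro x y hx hy α hα
    rw [Aalpha, Aalpha, if_neg (by simp [hα.le]), if_neg (by simp [hα.le]),
      rpow_le_rpow_iff (hpow x hx α) (hpow y hy α) (by positivity), mul_le_mul_iff_right₀ hd]
  have hAneg : ∀ x y : Fin d → ℝ, (∀ i, 0 < x i) → (∀ i, 0 < y i) → ∀ α : ℝ, α < 0 →
      (Aalpha d α y ≤ Aalpha d α x ↔ ∑ i, x i ^ α ≤ ∑ i, y i ^ α) := by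
    intro x y hx hy α hα
    have hpos : ∀ x : Fin d → ℝ, (∀ i, 0 < x i) → 0 < 1 / (d : ℝ) * ∑ i, x i ^ α := by
      intro x hx
      refine mul_pos hd (Finset.sum_pos (fun i _ => rpow_pos_of_pos (hx i) α) ?_)
      rcases Nat.eq_zero_or_pos d with rfl | h
      · simp at hd
      · exact ⟨⟨0, h⟩, mem_univ _⟩
    have hx' : ¬ (α < 0 ∧ ∃ i, x i = 0) := fun h => h.2.elim fun i hi => (hx i).ne' hi
    have hy' : ¬ (α < 0 ∧ ∃ i, y i = 0) := fun h => h.2.elim fun i hi => (hy i).ne' hi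
    rw [Aalpha, Aalpha, if_neg hx', if_neg hy',
      rpow_le_rpow_iff_of_neg (hpos y hy) (hpos x hx) (one_div_neg.2 hα), mul_le_mul_iff_right₀ hd]
  have hposof : (∏ i, q i ≤ ∏ i, p i) → (∀ i, 0 < q i) → ∀ i, 0 < p i := by
    intro h hq0 i
    have h1 : 0 < ∏ i, p i := (Finset.prod_pos fun i _ => hq0 i).trans_le h
    exact lt_of_le_of_ne (hp.1 i) fun h0 => h1.ne' (Finset.prod_eq_zero (mem_univ i) h0.symm)
  have hlog : (∀ i, 0 < q i) → (∀ i, 0 < p i) →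
      (∏ i, q i ≤ ∏ i, p i ↔ ∑ i, log (q i) ≤ ∑ i, log (p i)) := by
    intro hq0 hp0
    rw [← log_prod fun i _ => (hq0 i).ne', ← log_prod fun i _ => (hp0 i).ne',
      log_le_log_iff (Finset.prod_pos fun i _ => hq0 i) (Finset.prod_pos fun i _ => hp0 i)]
  constructor
  · intro h
    refine ⟨fun α h0 h1 => (hApos q p hq.1 hp.1 α h0).2 (h.lt_one α h0 h1), ?_, fun α hα => ?_,
      fun α hα => (hApos p q hp.1 hq.1 α (by linarith)).2 (h.one_lt α hα), neg_le_neg h.entropy⟩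
    · by_cases hq0 : ∀ i, 0 < q i
      · exact (hlog hq0 (h.pos hq0)).2 (h.log hq0)
      · push Not at hq0
        obtain ⟨i, hi⟩ := hq0
        rw [Finset.prod_eq_zero (mem_univ i) (le_antisymm hi (hq.1 i))]
        exact Finset.prod_nonneg fun i _ => hp.1 i
    · by_cases hq0 : ∀ i, 0 < q i
      · exact (hAneg p q (h.pos hq0) hq0 α hα).2 (h.neg hq0 α hα)
      · push Not at hq0
        obtain ⟨i, hi⟩ := hq0
        have : Aalpha d α q = 0 := if_pos ⟨hα, i, le_antisymm hi (hq.1 i)⟩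
        rw [this]
        exact hAnn p hp.1 α
  · rintro ⟨h01, hprod, hneg, hgt, hent⟩
    exact ⟨fun α hα => (hApos p q hp.1 hq.1 α (by linarith)).1 (hgt α hα),
      fun α h0 h1 => (hApos q p hq.1 hp.1 α h0).1 (h01 α h0 h1), neg_le_neg_iff.1 hent,
      hposof hprod, fun hq0 α hα => (hAneg p q (hposof hprod hq0) hq0 α hα).1 (hneg α hα),
      fun hq0 => (hlog hq0 (hposof hprod hq0)).1 hprod⟩

end Power

section Positivity

open Polynomial

lemma cast_descFactorial_eq_prod (n k : ℕ) :
    (n.descFactorial k : ℝ) = ∏ i ∈ Finset.range k, ((n : ℝ) - i) := by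
  induction k with
  | zero => simp
  | succ k ih =>
    rw [Nat.descFactorial_succ, Finset.prod_range_succ, ← ih, Nat.cast_mul]
    rcases le_or_gt k n with h | h
    · rw [Nat.cast_sub h, mul_comm]
    · simp [Nat.descFactorial_of_lt h]

lemma choose_mul_descFactorial {N D j k : ℕ} (hj : j ≤ D) (hk : k ≤ N + D) :
    (if j ≤ k then N.choose (k - j) else 0) * (N + D).descFactorial D =
      (N + D).choose k * (k.descFactorial j * (N + D - k).descFactorial (D - j)) := by
  split_ifs with hjk
  · rcases le_or_gt (k - j) N with h | h
    · have e1 := Nat.choose_mul_factorial_mul_factorial h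
      have e2 := Nat.choose_mul_factorial_mul_factorial hk
      have e3 := Nat.factorial_mul_descFactorial hjk
      have e4 := Nat.factorial_mul_descFactorial (show D - j ≤ N + D - k by omega)
      have e5 := Nat.factorial_mul_descFactorial (show D ≤ N + D by omega)
      rw [show N + D - k - (D - j) = N - (k - j) by omega] at e4
      rw [show N + D - D = N by omega] at e5
      have hpos : 0 < (k - j).factorial * (N - (k - j)).factorial :=
        Nat.mul_pos (Nat.factorial_pos _) (Nat.factorial_pos _)
      refine Nat.eq_of_mul_eq_mul_right hpos ?_
      calc _ = (N.choose (k - j) * (k - j).factorial * (N - (k - j)).factorial) *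
            (N + D).descFactorial D := by ring
        _ = (N + D).choose k * k.factorial * (N + D - k).factorial := by rw [e1, e5, e2]
        _ = _ := by rw [← e3, ← e4]; ring
    · rw [Nat.choose_eq_zero_of_lt h, Nat.descFactorial_of_lt (show N + D - k < D - j by omega)]
      simp
  · rw [Nat.descFactorial_of_lt (not_le.1 hjk)]
    simp

lemma coeff_one_add_X_pow_mul (F : ℝ[X]) (N k : ℕ) :
    ((1 + X) ^ N * F).coeff k = ∑ j ∈ Finset.range (F.natDegree + 1),
      F.coeff j * ((if j ≤ k then N.choose (k - j) else 0 : ℕ) : ℝ) := by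
  conv_lhs => rw [F.as_sum_range_C_mul_X_pow, Finset.mul_sum]
  rw [finsetSum_coeff]
  refine Finset.sum_congr rfl fun j _ => ?_
  rw [mul_left_comm, coeff_C_mul, coeff_mul_X_pow']
  split_ifs
  · rw [coeff_one_add_X_pow]
  · simp

/-- Homogenization of `F` in which powers are replaced by rising products of step `-h`. -/
lemma homogenization_pos {F : ℝ[X]} (hF : ∀ x, 0 ≤ x → 0 < F.eval x) (hlead : 0 < F.leadingCoeff)
    {t : ℝ} (ht : t ∈ Set.Icc (0 : ℝ) 1) :
    0 < ∑ j ∈ Finset.range (F.natDegree + 1), F.coeff j * (t ^ j * (1 - t) ^ (F.natDegree - j)) := by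
  rcases eq_or_lt_of_le ht.2 with rfl | h1
  · rw [Finset.sum_range_succ, Finset.sum_eq_zero]
    · simpa using hlead
    · intro j hj
      rw [Finset.mem_range] at hj
      simp [show F.natDegree - j ≠ 0 by omega]
  · have hs : 0 < 1 - t := by linarith
    have : ∑ j ∈ Finset.range (F.natDegree + 1),
        F.coeff j * (t ^ j * (1 - t) ^ (F.natDegree - j)) =
        (1 - t) ^ F.natDegree * F.eval (t / (1 - t)) := by
      rw [eval_eq_sum_range, Finset.mul_sum]
      refine Finset.sum_congr rfl fun j hj => ?_
      have hj' : j ≤ F.natDegree := by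
        rw [Finset.mem_range] at hj; omega
      rw [div_pow, ← Nat.sub_add_cancel hj', pow_add, Nat.add_sub_cancel]
      field_simp
    rw [this]
    exact mul_pos (pow_pos hs _) (hF _ (div_nonneg ht.1 hs.le))

/-- Poincaré's theorem: a real polynomial that is positive on `[0, ∞)` gets nonnegative
coefficients after multiplication by a power of `1 + X`. -/
lemma exists_one_add_X_pow_mul_coeff_nonneg {F : ℝ[X]} (hF : ∀ x, 0 ≤ x → 0 < F.eval x)
    (hlead : 0 < F.leadingCoeff) : ∃ N : ℕ, ∀ k, 0 ≤ ((1 + X) ^ N * F).coeff k := by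
  set D := F.natDegree with hD
  let H : ℝ → ℝ → ℝ := fun h t => ∑ j ∈ Finset.range (D + 1), F.coeff j *
    ((∏ i ∈ Finset.range j, (t - i * h)) * ∏ i ∈ Finset.range (D - j), (1 - t - i * h))
  have hev : ∀ᶠ h in nhds (0 : ℝ), ∀ t ∈ Set.Icc (0 : ℝ) 1, 0 < H h t := by
    refine isCompact_Icc.eventually_forall_of_forall_eventually fun t ht => ?_
    have hc : Continuous fun z : ℝ × ℝ => H z.1 z.2 := by
      simp only [H]
      fun_prop
    refine hc.continuousAt.eventually (lt_mem_nhds ?_)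
    simpa [H] using homogenization_pos hF hlead ht
  obtain ⟨N, hN⟩ : ∃ N : ℕ, ∀ t ∈ Set.Icc (0 : ℝ) 1, 0 < H (1 / ((N : ℝ) + 1 + D)) t := by
    have htend : Filter.Tendsto (fun N : ℕ => 1 / ((N : ℝ) + 1 + D)) Filter.atTop (nhds 0) := by
      refine tendsto_const_nhds.div_atTop ?_
      exact Filter.tendsto_atTop_add_const_right _ _
        (Filter.tendsto_atTop_add_const_right _ _ tendsto_natCast_atTop_atTop)
    exact (htend.eventually hev).exists
  refine ⟨N + 1, fun k => ?_⟩
  rw [coeff_one_add_X_pow_mul, ← hD]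
  rcases lt_or_ge (N + 1 + D) k with hk | hk
  · refine (Finset.sum_eq_zero fun j hj => ?_).ge
    rw [Finset.mem_range] at hj
    rw [if_pos (by omega), Nat.choose_eq_zero_of_lt (by omega)]
    simp
  have hdesc : (0 : ℝ) < (N + 1 + D).descFactorial D := by
    exact_mod_cast Nat.descFactorial_pos.2 (by omega)
  refine nonneg_of_mul_nonneg_left (b := ((N + 1 + D).descFactorial D : ℝ)) ?_ hdesc
  set T : ℝ := (N : ℝ) + 1 + D with hT
  have hT0 : 0 < T := by positivity
  have hkT : (k : ℝ) ≤ T := by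
    rw [hT]; exact_mod_cast hk
  have key : (∑ j ∈ Finset.range (D + 1),
      F.coeff j * ((if j ≤ k then (N + 1).choose (k - j) else 0 : ℕ) : ℝ)) *
        ((N + 1 + D).descFactorial D : ℝ) =
      (N + 1 + D).choose k * (T ^ D * H (1 / T) (k / T)) := by
    simp only [H]
    rw [Finset.sum_mul, Finset.mul_sum, Finset.mul_sum]
    refine Finset.sum_congr rfl fun j hj => ?_
    have hj' : j ≤ D := by
      rw [Finset.mem_range] at hj; omega
    rw [mul_assoc, ← Nat.cast_mul, choose_mul_descFactorial hj' hk]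
    push_cast
    rw [cast_descFactorial_eq_prod, cast_descFactorial_eq_prod, Nat.cast_sub hk]
    have e1 : ∏ i ∈ Finset.range j, ((k : ℝ) - i) =
        T ^ j * ∏ i ∈ Finset.range j, ((k : ℝ) / T - i * (1 / T)) := by
      rw [← Finset.card_range j, ← Finset.prod_const, Finset.card_range, ← Finset.prod_mul_distrib]
      refine Finset.prod_congr rfl fun i _ => ?_
      field_simp
    have e2 : ∏ i ∈ Finset.range (D - j), (((N + 1 + D : ℕ) : ℝ) - k - i) =
        T ^ (D - j) * ∏ i ∈ Finset.range (D - j), (1 - (k : ℝ) / T - i * (1 / T)) := by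
      rw [← Finset.card_range (D - j), ← Finset.prod_const, Finset.card_range,
        ← Finset.prod_mul_distrib]
      refine Finset.prod_congr rfl fun i _ => ?_
      have : ((N + 1 + D : ℕ) : ℝ) = T := by rw [hT]; push_cast; ring
      rw [this]
      field_simp
    rw [e1, e2]
    have e3 : T ^ D = T ^ j * T ^ (D - j) := by rw [← pow_add, Nat.add_sub_cancel' hj']
    rw [e3]
    ring
  rw [key]
  have := hN (k / T) ⟨by positivity, (div_le_one hT0).2 hkT⟩
  positivity

variable {ι : Type*} [Fintype ι]

lemma one_add_X_pow_mul_sum (a : ι → ℕ) (N : ℕ) :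
    (1 + X : ℝ[X]) ^ N * ∑ i, X ^ a i = ∑ i, ∑ S : Finset (Fin N), X ^ (a i + S.card) := by
  have h := Fin.sum_pow_mul_eq_add_pow (n := N) (X : ℝ[X]) 1
  simp only [one_pow, mul_one] at h
  rw [add_comm 1 X, ← h, Finset.mul_sum]
  refine Finset.sum_congr rfl fun i _ => ?_
  rw [Finset.sum_mul]
  exact Finset.sum_congr rfl fun S _ => by rw [pow_add, mul_comm]

/-- Sign conditions on the difference of two exponential sums on a geometric grid produce a
binomial catalyst, tested against all functions that are convex along the grid. -/
lemma exists_binomial_catalyst {ω : ℝ} (hω : 1 < ω) {a b : ι → ℕ}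
    (ha : ∀ i, 0 < a i) (hb : ∃ i, b i = 0)
    (hroot : ∑ i, ω ^ a i = ∑ i, ω ^ b i)
    (hlow : ∀ x : ℝ, 0 < x → x < 1 → ∑ i, x ^ a i < ∑ i, x ^ b i)
    (hmid : ∀ x : ℝ, 1 < x → x < ω → ∑ i, x ^ b i < ∑ i, x ^ a i)
    (hhigh : ∀ x : ℝ, ω < x → ∑ i, x ^ a i < ∑ i, x ^ b i)
    (hone : ∑ i, (b i : ℝ) < ∑ i, (a i : ℝ))
    (hom : ∑ i, (a i : ℝ) * ω ^ a i < ∑ i, (b i : ℝ) * ω ^ b i) :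
    ∃ N : ℕ, ∀ φ : ℕ → ℝ, (∀ k, (1 + ω) * φ (k + 1) ≤ φ (k + 2) + ω * φ k) →
      ∑ i, ∑ S : Finset (Fin N), φ (a i + S.card) ≤ ∑ i, ∑ S : Finset (Fin N), φ (b i + S.card) := by
  set P : ℝ[X] := ∑ i, X ^ b i - ∑ i, X ^ a i with hP
  have heval : ∀ x, P.eval x = ∑ i, x ^ b i - ∑ i, x ^ a i := by
    intro x
    simp [hP, eval_finsetSum]
  obtain ⟨G, hG⟩ : X - C 1 ∣ P := dvd_iff_isRoot.2 (by simp [IsRoot, heval])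
  obtain ⟨F, hF⟩ : X - C ω ∣ G := by
    refine dvd_iff_isRoot.2 ?_
    have h := heval ω
    rw [hG, hroot, sub_self] at h
    simpa [sub_ne_zero.2 hω.ne'] using h
  have hPF : P = (X - C 1) * (X - C ω) * F := by rw [hG, hF, mul_assoc]
  have hevalF : ∀ x, (x - 1) * (x - ω) * F.eval x = ∑ i, x ^ b i - ∑ i, x ^ a i := by
    intro x
    rw [← heval, hPF]
    simp
  have hderiv : ∀ x, x * P.derivative.eval x =
      ∑ i, (b i : ℝ) * x ^ b i - ∑ i, (a i : ℝ) * x ^ a i := by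
    intro x
    have h : ∀ n : ℕ, x * ((n : ℝ) * x ^ (n - 1)) = n * x ^ n := by
      intro n
      rcases n with _ | n
      · simp
      · rw [Nat.add_sub_cancel, pow_succ]; ring
    simp only [hP, derivative_sub, derivative_sum, derivative_X_pow, eval_sub, eval_finsetSum,
      eval_mul, eval_C, eval_pow, eval_X, mul_sub, Finset.mul_sum, h]
  have hderivF : ∀ x, P.derivative.eval x = (x - ω) * F.eval x + (x - 1) * F.eval x +
      (x - 1) * (x - ω) * F.derivative.eval x := by
    intro x
    rw [hPF]
    simp only [derivative_mul, derivative_sub, derivative_X, derivative_C, eval_add, eval_mul,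
      eval_sub, eval_X, eval_C, eval_one, eval_zero]
    ring
  have hpos : ∀ x, 0 ≤ x → 0 < F.eval x := by
    intro x hx
    have hx' := hevalF x
    rcases eq_or_lt_of_le hx with rfl | hx
    · obtain ⟨i, hi⟩ := hb
      have h1 : ∑ i, (0 : ℝ) ^ a i = 0 := Finset.sum_eq_zero fun i _ => zero_pow (ha i).ne'
      have h2 : (1 : ℝ) ≤ ∑ i, (0 : ℝ) ^ b i := by
        have := Finset.single_le_sum (f := fun i => (0 : ℝ) ^ b i) (fun i _ => by positivity)
          (mem_univ i)
        simpa [hi] using this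
      rw [h1] at hx'
      by_contra hneg
      nlinarith
    rcases lt_trichotomy x 1 with h | rfl | h
    · have := hlow x hx h
      have h3 : 0 < (x - 1) * (x - ω) := mul_pos_of_neg_of_neg (by linarith) (by linarith)
      by_contra hneg
      nlinarith
    · have h1 := hderiv 1
      rw [hderivF] at h1
      simp only [one_pow, mul_one] at h1
      by_contra hneg
      nlinarith
    rcases lt_trichotomy x ω with h' | rfl | h'
    · have := hmid x h h'
      have h3 : (x - 1) * (x - ω) < 0 := mul_neg_of_pos_of_neg (by linarith) (by linarith)
      by_contra hneg
      nlinarith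
    · have h1 := hderiv x
      rw [hderivF] at h1
      simp only [sub_self, zero_mul, mul_zero, zero_add, add_zero] at h1
      have h3 : 0 < x * (x - 1) := mul_pos hx (by linarith)
      by_contra hneg
      nlinarith
    · have := hhigh x h'
      have h3 : 0 < (x - 1) * (x - ω) := mul_pos (by linarith) (by linarith)
      by_contra hneg
      nlinarith
  have hlead : 0 < F.leadingCoeff := by
    by_contra hneg
    rw [not_lt] at hneg
    rcases Nat.eq_zero_or_pos F.natDegree with h | h
    · have h1 := hpos 0 le_rfl
      rw [leadingCoeff, h] at hneg
      rw [← coeff_zero_eq_eval_zero] at h1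
      linarith
    · have := F.tendsto_atBot_of_leadingCoeff_nonpos (natDegree_pos_iff_degree_pos.1 h) hneg
      obtain ⟨x, hx, hx0⟩ :=
        ((this.eventually_lt_atBot 0).and (Filter.eventually_ge_atTop 0)).exists
      exact absurd (hpos x hx0) (not_lt.2 hx.le)
  obtain ⟨N, hN⟩ := exists_one_add_X_pow_mul_coeff_nonneg hpos hlead
  refine ⟨N, fun φ hφ => ?_⟩
  let L : ℝ[X] →ₗ[ℝ] ℝ := Polynomial.lsum fun k => φ k • LinearMap.id
  have hL : ∀ k, L (X ^ k) = φ k := by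
    intro k
    simp [L, X_pow_eq_monomial, Polynomial.lsum_apply, sum_monomial_index]
  have hQ : (1 + X) ^ N * P = ∑ i, ∑ S : Finset (Fin N), X ^ (b i + S.card) -
      ∑ i, ∑ S : Finset (Fin N), X ^ (a i + S.card) := by
    rw [hP, mul_sub, one_add_X_pow_mul_sum, one_add_X_pow_mul_sum]
  have hQ' : (1 + X) ^ N * P = ∑ k ∈ Finset.range (((1 + X) ^ N * F).natDegree + 1),
      ((1 + X) ^ N * F).coeff k • (X ^ (k + 2) - (1 + ω) • X ^ (k + 1) + ω • X ^ k) := by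
    have : (1 + X) ^ N * P = (X - C 1) * (X - C ω) * ((1 + X) ^ N * F) := by rw [hPF]; ring
    rw [this]
    conv_lhs => rw [as_sum_range_C_mul_X_pow ((1 + X) ^ N * F), Finset.mul_sum]
    refine Finset.sum_congr rfl fun k _ => ?_
    simp only [smul_eq_C_mul, map_add, map_one]
    ring
  have hnonneg : 0 ≤ L ((1 + X) ^ N * P) := by
    rw [hQ', _root_.map_sum]
    refine Finset.sum_nonneg fun k _ => ?_
    rw [LinearMap.map_smul, LinearMap.map_add, LinearMap.map_sub, LinearMap.map_smul,
      LinearMap.map_smul, hL, hL, hL]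
    simp only [smul_eq_mul]
    refine mul_nonneg (hN k) ?_
    linarith [hφ k]
  rw [hQ, L.map_sub] at hnonneg
  simp only [_root_.map_sum, hL] at hnonneg
  linarith

end Positivity

/-- A catalyst for two vectors whose entries lie on a common geometric grid. -/
lemma exists_catalyst_of_grid {ι : Type*} [Fintype ι] {ω c : ℝ} (hω : 1 < ω) (hc : 0 < c)
    {a b : ι → ℕ} {x y : ι → ℝ} (hx : ∀ i, x i = c * ω ^ a i) (hy : ∀ i, y i = c * ω ^ b i)
    (hsum : ∑ i, x i = ∑ i, y i)
    (ha : ∀ i, 0 < a i) (hb : ∃ i, b i = 0)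
    (hlow : ∀ x : ℝ, 0 < x → x < 1 → ∑ i, x ^ a i < ∑ i, x ^ b i)
    (hmid : ∀ x : ℝ, 1 < x → x < ω → ∑ i, x ^ b i < ∑ i, x ^ a i)
    (hhigh : ∀ x : ℝ, ω < x → ∑ i, x ^ a i < ∑ i, x ^ b i)
    (hone : ∑ i, (b i : ℝ) < ∑ i, (a i : ℝ))
    (hom : ∑ i, (a i : ℝ) * ω ^ a i < ∑ i, (b i : ℝ) * ω ^ b i) :
    ∃ m : ℕ, 1 ≤ m ∧ ∃ r : Fin m → ℝ, IsProbVec r ∧ Maj (tensor x r) (tensor y r) := by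
  have hroot : ∑ i, ω ^ a i = ∑ i, ω ^ b i := by
    simp only [hx, hy, ← Finset.mul_sum] at hsum
    exact mul_left_cancel₀ hc.ne' hsum
  obtain ⟨N, hN⟩ := exists_binomial_catalyst hω ha hb hroot hlow hmid hhigh hone hom
  set Z : ℝ := (ω + 1) ^ N with hZ
  have hZ0 : 0 < Z := by positivity
  have hω0 : 0 < ω := by linarith
  let e := Fintype.equivFin (Finset (Fin N))
  let r₀ : Finset (Fin N) → ℝ := fun S => ω ^ S.card / Z
  have hr : IsProbVec (r₀ ∘ e.symm) := by
    refine ⟨fun j => by simp only [r₀, Function.comp]; positivity, ?_⟩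
    have h1 : ∑ j, (r₀ ∘ e.symm) j = ∑ S, r₀ S := Equiv.sum_comp e.symm r₀
    have h2 := Fin.sum_pow_mul_eq_add_pow (n := N) ω 1
    simp only [one_pow, mul_one] at h2
    rw [h1, ← Finset.sum_div, h2]
    exact div_self hZ0.ne'
  refine ⟨Fintype.card (Finset (Fin N)), Fintype.card_pos, r₀ ∘ e.symm, hr, ?_⟩
  have hten : ∀ (v : ι → ℝ) (φ : ℝ → ℝ),
      ∑ z, φ (tensor v (r₀ ∘ e.symm) z) = ∑ i, ∑ S, φ (v i * r₀ S) := by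
    intro v φ
    rw [Fintype.sum_prod_type]
    exact Finset.sum_congr rfl fun i _ => Equiv.sum_comp e.symm fun S => φ (v i * r₀ S)
  refine maj_of_hinge_le ?_ fun t => ?_
  · have h1 := hten x id
    have h2 := hten y id
    simp only [id] at h1 h2
    rw [h1, h2, ← Finset.sum_mul_sum, ← Finset.sum_mul_sum, hsum]
  · have h1 := hten x fun z => max (z - t) 0
    have h2 := hten y fun z => max (z - t) 0
    rw [h1, h2]
    have key := hN (fun k => max (c / Z * ω ^ k - t) 0) fun k => by
      have hk : (1 + ω) * (c / Z * ω ^ (k + 1) - t) =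
          (c / Z * ω ^ (k + 2) - t) + ω * (c / Z * ω ^ k - t) := by ring
      have m1 := le_max_left (c / Z * ω ^ (k + 2) - t) 0
      have m2 := mul_le_mul_of_nonneg_left (le_max_left (c / Z * ω ^ k - t) 0) hω0.le
      have m3 := le_max_right (c / Z * ω ^ (k + 2) - t) 0
      have m4 := mul_nonneg hω0.le (le_max_right (c / Z * ω ^ k - t) 0)
      rcases max_cases (c / Z * ω ^ (k + 1) - t) 0 with ⟨h, _⟩ | ⟨h, _⟩
      · rw [h, hk]; linarith
      · rw [h]; linarith
    have conv : ∀ (v : ι → ℝ) (n : ι → ℕ), (∀ i, v i = c * ω ^ n i) → ∀ i (S : Finset (Fin N)),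
        v i * r₀ S = c / Z * ω ^ (n i + S.card) := by
      intro v n hv i S
      simp only [r₀, hv, pow_add]
      ring
    simpa only [conv x a hx, conv y b hy] using key

/-- The strict sign condition on power sums at the exponent `α`. -/
structure PowerSumSign {ι : Type*} [Fintype ι] (α : ℝ) (x y : ι → ℝ) : Prop where
  neg : α < 0 → ∑ i, x i ^ α < ∑ i, y i ^ α
  mid : 0 < α → α < 1 → ∑ i, y i ^ α < ∑ i, x i ^ α
  one_lt : 1 < α → ∑ i, x i ^ α < ∑ i, y i ^ α

/-- The strict version of `RenyiLE`, including the two infinite orders. -/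
structure StrictRenyi {ι : Type*} [Fintype ι] (x y : ι → ℝ) : Prop where
  pos : ∀ i, 0 < x i
  nonneg : ∀ i, 0 ≤ y i
  exists_max : ∃ i, ∀ j, x j < y i
  exists_min : ∃ i, ∀ j, y i < x j
  sign : (∀ i, 0 < y i) → ∀ α, PowerSumSign α x y
  sign_of_pos : ∀ α, 0 < α → PowerSumSign α x y
  entropy : ∑ i, x i * Real.log (x i) < ∑ i, y i * Real.log (y i)
  log : (∀ i, 0 < y i) → ∑ i, Real.log (y i) < ∑ i, Real.log (x i)

section Perturbation

open Real Filter Topology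

variable {ι : Type*} [Fintype ι] {x y : ι → ℝ}

lemma rpow_tangent_le {v : ℝ} (hv : 0 < v) (α β : ℝ) :
    v ^ α + (β - α) * (v ^ α * log v) ≤ v ^ β := by
  have h1 : v ^ β = v ^ α * v ^ (β - α) := by rw [← rpow_add hv]; congr 1; ring
  have h2 : log v * (β - α) + 1 ≤ v ^ (β - α) := by
    rw [rpow_def_of_pos hv]
    exact add_one_le_exp _
  have h3 := mul_le_mul_of_nonneg_left h2 (rpow_pos_of_pos hv α).le
  rw [h1]
  linarith

lemma sum_rpow_tangent_le {v : ι → ℝ} (hv : ∀ i, 0 < v i) (α β : ℝ) :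
    ∑ i, v i ^ α + (β - α) * ∑ i, v i ^ α * log (v i) ≤ ∑ i, v i ^ β := by
  rw [Finset.mul_sum, ← Finset.sum_add_distrib]
  exact Finset.sum_le_sum fun i _ => rpow_tangent_le (hv i) α β

lemma continuousAt_sum_rpow {E : Type*} [TopologicalSpace E] {f : E → ι → ℝ} {g : E → ℝ} {e : E}
    (hf : ContinuousAt f e) (hg : ContinuousAt g e) (h : ∀ i, f e i ≠ 0 ∨ 0 < g e) :
    ContinuousAt (fun e => ∑ i, f e i ^ g e) e :=
  tendsto_finsetSum _ fun i _ =>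
    ContinuousAt.rpow ((continuous_apply i).continuousAt.comp hf) hg (h i)

lemma eventually_sign_of_one_lt {α₀ : ℝ} (hα : 1 < α₀) (h : PowerSumSign α₀ x y) :
    ∀ᶠ w : ((ι → ℝ) × (ι → ℝ)) × ℝ in 𝓝 ((x, y), α₀), PowerSumSign w.2 w.1.1 w.1.2 := by
  have h0 : 0 < α₀ := by linarith
  have c1 : ContinuousAt (fun w : ((ι → ℝ) × (ι → ℝ)) × ℝ => ∑ i, w.1.1 i ^ w.2) ((x, y), α₀) :=
    continuousAt_sum_rpow (by fun_prop) (by fun_prop) fun i => Or.inr h0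
  have c2 : ContinuousAt (fun w : ((ι → ℝ) × (ι → ℝ)) × ℝ => ∑ i, w.1.2 i ^ w.2) ((x, y), α₀) :=
    continuousAt_sum_rpow (by fun_prop) (by fun_prop) fun i => Or.inr h0
  have c3 : ContinuousAt (fun w : ((ι → ℝ) × (ι → ℝ)) × ℝ => w.2) ((x, y), α₀) := by fun_prop
  filter_upwards [c1.eventually_lt c2 (h.one_lt hα), c3.eventually (lt_mem_nhds hα)] with w h1 h2
  exact ⟨fun h => absurd h (by linarith), fun _ h => absurd h (by linarith), fun _ => h1⟩

lemma eventually_sign_of_mid {α₀ : ℝ} (h0 : 0 < α₀) (hα : α₀ < 1) (h : PowerSumSign α₀ x y) :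
    ∀ᶠ w : ((ι → ℝ) × (ι → ℝ)) × ℝ in 𝓝 ((x, y), α₀), PowerSumSign w.2 w.1.1 w.1.2 := by
  have c1 : ContinuousAt (fun w : ((ι → ℝ) × (ι → ℝ)) × ℝ => ∑ i, w.1.1 i ^ w.2) ((x, y), α₀) :=
    continuousAt_sum_rpow (by fun_prop) (by fun_prop) fun i => Or.inr h0
  have c2 : ContinuousAt (fun w : ((ι → ℝ) × (ι → ℝ)) × ℝ => ∑ i, w.1.2 i ^ w.2) ((x, y), α₀) :=
    continuousAt_sum_rpow (by fun_prop) (by fun_prop) fun i => Or.inr h0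
  have c3 : ContinuousAt (fun w : ((ι → ℝ) × (ι → ℝ)) × ℝ => w.2) ((x, y), α₀) := by fun_prop
  filter_upwards [c2.eventually_lt c1 (h.mid h0 hα), c3.eventually (lt_mem_nhds h0),
    c3.eventually (gt_mem_nhds hα)] with w h1 h2 h3
  exact ⟨fun h => absurd h (by linarith), fun _ _ => h1, fun h => absurd h (by linarith)⟩

lemma eventually_sign_of_neg {α₀ : ℝ} (h0 : α₀ < 0) (hx : ∀ i, 0 < x i) (hy : ∀ i, 0 < y i)
    (h : PowerSumSign α₀ x y) :
    ∀ᶠ w : ((ι → ℝ) × (ι → ℝ)) × ℝ in 𝓝 ((x, y), α₀), PowerSumSign w.2 w.1.1 w.1.2 := by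
  have c1 : ContinuousAt (fun w : ((ι → ℝ) × (ι → ℝ)) × ℝ => ∑ i, w.1.1 i ^ w.2) ((x, y), α₀) :=
    continuousAt_sum_rpow (by fun_prop) (by fun_prop) fun i => Or.inl (hx i).ne'
  have c2 : ContinuousAt (fun w : ((ι → ℝ) × (ι → ℝ)) × ℝ => ∑ i, w.1.2 i ^ w.2) ((x, y), α₀) :=
    continuousAt_sum_rpow (by fun_prop) (by fun_prop) fun i => Or.inl (hy i).ne'
  have c3 : ContinuousAt (fun w : ((ι → ℝ) × (ι → ℝ)) × ℝ => w.2) ((x, y), α₀) := by fun_prop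
  filter_upwards [c1.eventually_lt c2 (h.neg h0), c3.eventually (gt_mem_nhds h0)] with w h1 h2
  exact ⟨fun _ => h1, fun h => absurd h (by linarith), fun h => absurd h (by linarith)⟩

lemma eventually_sign_zero (hx : ∀ i, 0 < x i) (hy : ∀ i, 0 < y i)
    (h : ∑ i, log (y i) < ∑ i, log (x i)) :
    ∀ᶠ w : ((ι → ℝ) × (ι → ℝ)) × ℝ in 𝓝 ((x, y), 0), PowerSumSign w.2 w.1.1 w.1.2 := by
  have l1 : ∀ i, ContinuousAt (fun w : ((ι → ℝ) × (ι → ℝ)) × ℝ => log (w.1.1 i)) ((x, y), 0) :=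
    fun i => ContinuousAt.log (by fun_prop) (hx i).ne'
  have l2 : ∀ i, ContinuousAt (fun w : ((ι → ℝ) × (ι → ℝ)) × ℝ => log (w.1.2 i)) ((x, y), 0) :=
    fun i => ContinuousAt.log (by fun_prop) (hy i).ne'
  have c1 : ContinuousAt (fun w : ((ι → ℝ) × (ι → ℝ)) × ℝ => ∑ i, log (w.1.1 i)) ((x, y), 0) :=
    tendsto_finsetSum _ fun i _ => l1 i
  have c2 : ContinuousAt (fun w : ((ι → ℝ) × (ι → ℝ)) × ℝ => ∑ i, log (w.1.2 i)) ((x, y), 0) :=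
    tendsto_finsetSum _ fun i _ => l2 i
  have d1 : ContinuousAt (fun w : ((ι → ℝ) × (ι → ℝ)) × ℝ =>
      ∑ i, w.1.1 i ^ w.2 * log (w.1.1 i)) ((x, y), 0) :=
    tendsto_finsetSum _ fun i _ =>
      (ContinuousAt.rpow (f := fun w : ((ι → ℝ) × (ι → ℝ)) × ℝ => w.1.1 i) (g := fun w => w.2)
        (by fun_prop) (by fun_prop) (Or.inl (hx i).ne')).mul (l1 i)
  have d2 : ContinuousAt (fun w : ((ι → ℝ) × (ι → ℝ)) × ℝ =>
      ∑ i, w.1.2 i ^ w.2 * log (w.1.2 i)) ((x, y), 0) :=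
    tendsto_finsetSum _ fun i _ =>
      (ContinuousAt.rpow (f := fun w : ((ι → ℝ) × (ι → ℝ)) × ℝ => w.1.2 i) (g := fun w => w.2)
        (by fun_prop) (by fun_prop) (Or.inl (hy i).ne')).mul (l2 i)
  have c3 : ContinuousAt (fun w : ((ι → ℝ) × (ι → ℝ)) × ℝ => w.2) ((x, y), 0) := by fun_prop
  have p1 : ∀ᶠ w : ((ι → ℝ) × (ι → ℝ)) × ℝ in 𝓝 ((x, y), 0), ∀ i, 0 < w.1.1 i :=
    eventually_all.2 fun i => continuousAt_const.eventually_lt (by fun_prop) (hx i)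
  have p2 : ∀ᶠ w : ((ι → ℝ) × (ι → ℝ)) × ℝ in 𝓝 ((x, y), 0), ∀ i, 0 < w.1.2 i :=
    eventually_all.2 fun i => continuousAt_const.eventually_lt (by fun_prop) (hy i)
  filter_upwards [c2.eventually_lt d1 (by simpa using h), d2.eventually_lt c1 (by simpa using h),
    c3.eventually (gt_mem_nhds zero_lt_one), p1, p2] with w h1 h2 h3 hw1 hw2
  refine ⟨fun hneg => ?_, fun hpos _ => ?_, fun h => absurd h (by linarith)⟩
  · have t1 := sum_rpow_tangent_le hw2 0 w.2
    have t2 := sum_rpow_tangent_le hw1 w.2 0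
    have t3 := mul_lt_mul_of_neg_left h1 hneg
    simp only [rpow_zero, one_mul, sub_zero, zero_sub] at t1 t2
    linarith
  · have t1 := sum_rpow_tangent_le hw1 0 w.2
    have t2 := sum_rpow_tangent_le hw2 w.2 0
    have t3 := mul_lt_mul_of_pos_left h2 hpos
    simp only [rpow_zero, one_mul, sub_zero, zero_sub] at t1 t2
    linarith

lemma eventually_sign_one (hx : ∀ i, 0 < x i)
    (h : ∑ i, x i * log (x i) < ∑ i, y i * log (y i)) :
    ∀ᶠ w : ((ι → ℝ) × (ι → ℝ)) × ℝ in 𝓝 ((x, y), 1), (∀ i, 0 < w.1.2 i) →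
      ∑ i, w.1.1 i = ∑ i, w.1.2 i → PowerSumSign w.2 w.1.1 w.1.2 := by
  have c1 : ContinuousAt (fun w : ((ι → ℝ) × (ι → ℝ)) × ℝ => ∑ i, w.1.1 i * log (w.1.1 i))
      ((x, y), 1) :=
    tendsto_finsetSum _ fun i _ => continuous_mul_log.continuousAt.comp
      (f := fun w : ((ι → ℝ) × (ι → ℝ)) × ℝ => w.1.1 i) (by fun_prop)
  have c2 : ContinuousAt (fun w : ((ι → ℝ) × (ι → ℝ)) × ℝ => ∑ i, w.1.2 i * log (w.1.2 i))
      ((x, y), 1) :=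
    tendsto_finsetSum _ fun i _ => continuous_mul_log.continuousAt.comp
      (f := fun w : ((ι → ℝ) × (ι → ℝ)) × ℝ => w.1.2 i) (by fun_prop)
  have d1 : ContinuousAt (fun w : ((ι → ℝ) × (ι → ℝ)) × ℝ =>
      ∑ i, w.1.1 i ^ w.2 * log (w.1.1 i ^ w.2) / w.2) ((x, y), 1) :=
    tendsto_finsetSum _ fun i _ => ContinuousAt.div (continuous_mul_log.continuousAt.comp
      (f := fun w : ((ι → ℝ) × (ι → ℝ)) × ℝ => w.1.1 i ^ w.2)
      (ContinuousAt.rpow (by fun_prop) (by fun_prop) (Or.inr one_pos))) (by fun_prop) one_ne_zero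
  have d2 : ContinuousAt (fun w : ((ι → ℝ) × (ι → ℝ)) × ℝ =>
      ∑ i, w.1.2 i ^ w.2 * log (w.1.2 i ^ w.2) / w.2) ((x, y), 1) :=
    tendsto_finsetSum _ fun i _ => ContinuousAt.div (continuous_mul_log.continuousAt.comp
      (f := fun w : ((ι → ℝ) × (ι → ℝ)) × ℝ => w.1.2 i ^ w.2)
      (ContinuousAt.rpow (by fun_prop) (by fun_prop) (Or.inr one_pos))) (by fun_prop) one_ne_zero
  have c3 : ContinuousAt (fun w : ((ι → ℝ) × (ι → ℝ)) × ℝ => w.2) ((x, y), 1) := by fun_prop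
  have p1 : ∀ᶠ w : ((ι → ℝ) × (ι → ℝ)) × ℝ in 𝓝 ((x, y), 1), ∀ i, 0 < w.1.1 i :=
    eventually_all.2 fun i => continuousAt_const.eventually_lt (by fun_prop) (hx i)
  filter_upwards [d1.eventually_lt c2 (by simpa using h), c1.eventually_lt d2 (by simpa using h),
    c3.eventually (lt_mem_nhds zero_lt_one), p1] with w h1 h2 h3 hw1 hw2 hsum
  have e : ∀ v : ι → ℝ, (∀ i, 0 < v i) → ∑ i, v i ^ w.2 * log (v i ^ w.2) / w.2 =
      ∑ i, v i ^ w.2 * log (v i) := by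
    intro v hv
    refine Finset.sum_congr rfl fun i _ => ?_
    rw [log_rpow (hv i)]
    field_simp
  rw [e _ hw1] at h1
  rw [e _ hw2] at h2
  refine ⟨fun h => absurd h (by linarith), fun _ hlt => ?_, fun hgt => ?_⟩
  · have t1 := sum_rpow_tangent_le hw1 1 w.2
    have t2 := sum_rpow_tangent_le hw2 w.2 1
    have t3 := mul_lt_mul_of_pos_left h2 (sub_pos.2 hlt)
    simp only [rpow_one] at t1 t2
    linarith
  · have t1 := sum_rpow_tangent_le hw2 1 w.2
    have t2 := sum_rpow_tangent_le hw1 w.2 1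
    have t3 := mul_lt_mul_of_pos_left h1 (sub_pos.2 hgt)
    simp only [rpow_one] at t1 t2
    linarith

lemma exists_forall_ge_card_lt_rpow {b : ℝ} (hb : 1 < b) (n : ℕ) :
    ∃ A : ℝ, ∀ α : ℝ, A ≤ α → (n : ℝ) < b ^ α :=
  eventually_atTop.1 ((tendsto_rpow_atTop_of_base_gt_one b hb).eventually_gt_atTop (n : ℝ))

lemma eventually_sign_atTop (hx : ∀ i, 0 < x i) (h : ∃ i, ∀ j, x j < y i) :
    ∃ A : ℝ, ∀ᶠ z : (ι → ℝ) × (ι → ℝ) in 𝓝 (x, y), (∀ i, 0 < z.2 i) →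
      ∀ α : ℝ, A ≤ α → ∑ i, z.1 i ^ α < ∑ i, z.2 i ^ α := by
  obtain ⟨i, hi⟩ := h
  obtain ⟨j₀, -, hj₀⟩ := Finset.exists_max_image univ x ⟨i, mem_univ i⟩
  obtain ⟨C, hC1, hC2⟩ := exists_between (hi j₀)
  obtain ⟨c, hc1, hc2⟩ := exists_between hC1
  have hc0 : 0 < c := (hx j₀).trans hc1
  obtain ⟨A, hA⟩ := exists_forall_ge_card_lt_rpow ((one_lt_div hc0).2 hc2) (Fintype.card ι)
  have p1 : ∀ᶠ z : (ι → ℝ) × (ι → ℝ) in 𝓝 (x, y), ∀ j, 0 < z.1 j :=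
    eventually_all.2 fun j => continuousAt_const.eventually_lt (by fun_prop) (hx j)
  have p2 : ∀ᶠ z : (ι → ℝ) × (ι → ℝ) in 𝓝 (x, y), ∀ j, z.1 j < c :=
    eventually_all.2 fun j => ContinuousAt.eventually_lt (by fun_prop) continuousAt_const
      ((hj₀ j (mem_univ j)).trans_lt hc1)
  have p3 : ∀ᶠ z : (ι → ℝ) × (ι → ℝ) in 𝓝 (x, y), C < z.2 i :=
    continuousAt_const.eventually_lt (by fun_prop) hC2
  refine ⟨max A 0, ?_⟩
  filter_upwards [p1, p2, p3] with z h1 h2 h3 hz α hα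
  have hα0 : 0 ≤ α := (le_max_right _ _).trans hα
  have hAα := hA α ((le_max_left _ _).trans hα)
  rw [div_rpow (hc0.le.trans hc2.le) hc0.le, lt_div_iff₀ (rpow_pos_of_pos hc0 α)] at hAα
  calc ∑ j, z.1 j ^ α ≤ ∑ _j : ι, c ^ α :=
        Finset.sum_le_sum fun j _ => rpow_le_rpow (h1 j).le (h2 j).le hα0
    _ = Fintype.card ι * c ^ α := by simp
    _ < C ^ α := hAα
    _ ≤ z.2 i ^ α := rpow_le_rpow (hc0.le.trans hc2.le) h3.le hα0
    _ ≤ _ := Finset.single_le_sum (f := fun i => z.2 i ^ α)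
        (fun i _ => (rpow_pos_of_pos (hz i) α).le) (mem_univ i)

lemma eventually_sign_atBot (hy : ∀ i, 0 ≤ y i) (h : ∃ i, ∀ j, y i < x j) :
    ∃ A : ℝ, ∀ᶠ z : (ι → ℝ) × (ι → ℝ) in 𝓝 (x, y), (∀ i, 0 < z.2 i) →
      ∀ α : ℝ, α ≤ A → ∑ i, z.1 i ^ α < ∑ i, z.2 i ^ α := by
  obtain ⟨i, hi⟩ := h
  obtain ⟨j₀, -, hj₀⟩ := Finset.exists_min_image univ x ⟨i, mem_univ i⟩
  obtain ⟨C, hC1, hC2⟩ := exists_between (hi j₀)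
  obtain ⟨c, hc1, hc2⟩ := exists_between hC1
  have hc0 : 0 < c := (hy i).trans_lt hc1
  have hC0 : 0 < C := hc0.trans hc2
  obtain ⟨A, hA⟩ := exists_forall_ge_card_lt_rpow ((one_lt_div hc0).2 hc2) (Fintype.card ι)
  have p2 : ∀ᶠ z : (ι → ℝ) × (ι → ℝ) in 𝓝 (x, y), ∀ j, C < z.1 j :=
    eventually_all.2 fun j => continuousAt_const.eventually_lt (by fun_prop)
      (hC2.trans_le (hj₀ j (mem_univ j)))
  have p3 : ∀ᶠ z : (ι → ℝ) × (ι → ℝ) in 𝓝 (x, y), z.2 i < c :=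
    ContinuousAt.eventually_lt (by fun_prop) continuousAt_const hc1
  refine ⟨-max A 0, ?_⟩
  filter_upwards [p2, p3] with z h2 h3 hz α hα
  have hα0 : α ≤ 0 := by linarith [le_max_right A 0]
  have hAα := hA (-α) (by linarith [le_max_left A 0])
  rw [rpow_neg (div_nonneg hC0.le hc0.le), div_rpow hC0.le hc0.le, inv_div,
    lt_div_iff₀ (rpow_pos_of_pos hC0 α)] at hAα
  calc ∑ j, z.1 j ^ α ≤ ∑ _j : ι, C ^ α :=
        Finset.sum_le_sum fun j _ => rpow_le_rpow_of_nonpos hC0 (h2 j).le hα0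
    _ = Fintype.card ι * C ^ α := by simp
    _ < c ^ α := hAα
    _ ≤ z.2 i ^ α := rpow_le_rpow_of_nonpos (hz i) h3.le hα0
    _ ≤ _ := Finset.single_le_sum (f := fun i => z.2 i ^ α)
        (fun i _ => (rpow_pos_of_pos (hz i) α).le) (mem_univ i)

/-- If `y` has a vanishing entry, then all small and all negative orders are under control near
`(x, y)`. -/
lemma eventually_sign_of_exists_zero (hx : ∀ i, 0 < x i) (hy : ∀ i, 0 ≤ y i) (h : ∃ i, y i = 0) :
    ∃ α₁, 0 < α₁ ∧ ∀ᶠ z : (ι → ℝ) × (ι → ℝ) in 𝓝 (x, y), (∀ i, 0 < z.2 i) →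
      ∑ i, log (z.2 i) < ∑ i, log (z.1 i) ∧ ∀ α, α ≤ α₁ → PowerSumSign α z.1 z.2 := by
  classical
  obtain ⟨i₀, hi₀⟩ := h
  obtain ⟨j₀, -, hj₀⟩ := Finset.exists_min_image univ x ⟨i₀, mem_univ i₀⟩
  obtain ⟨m, hm0, hm1⟩ := exists_between (hx j₀)
  set C : ℝ := 1 + ∑ i, y i / m with hC
  have hyC : ∀ i, y i / m ≤ C := by
    intro i
    have := Finset.single_le_sum (f := fun i => y i / m) (fun i _ => div_nonneg (hy i) hm0.le)
      (mem_univ i)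
    linarith
  have hC1 : 1 ≤ C := by
    have := Finset.sum_nonneg fun i (_ : i ∈ univ) => div_nonneg (hy i) hm0.le
    linarith
  set n : ℝ := (Fintype.card ι : ℝ) with hn
  obtain ⟨α₁, hα₁, hα₁1, hlt⟩ : ∃ α₁ : ℝ, 0 < α₁ ∧ α₁ < 1 ∧ (n - 1) * C ^ α₁ < n := by
    have hc : ContinuousAt (fun α : ℝ => (n - 1) * C ^ α) 0 :=
      continuousAt_const.mul (ContinuousAt.rpow (by fun_prop) (by fun_prop) (Or.inl (by linarith)))
    have h1 := (hc.eventually (gt_mem_nhds (show (n - 1) * C ^ (0 : ℝ) < n by simp))).filter_mono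
      (nhdsWithin_le_nhds (s := Set.Ioi 0))
    have h2 : ∀ᶠ α in 𝓝[>] (0 : ℝ), α ∈ Set.Ioo (0 : ℝ) 1 := Ioo_mem_nhdsGT one_pos
    obtain ⟨α, h3, h4⟩ := (h1.and h2).exists
    exact ⟨α, h4.1, h4.2, h3⟩
  refine ⟨α₁, hα₁, ?_⟩
  have hsum : ∑ i, (y i / m) ^ α₁ < n := by
    rw [← Finset.add_sum_erase _ _ (mem_univ i₀), hi₀, zero_div, zero_rpow hα₁.ne', zero_add]
    refine lt_of_le_of_lt ?_ hlt
    calc ∑ i ∈ univ.erase i₀, (y i / m) ^ α₁ ≤ ∑ i ∈ univ.erase i₀, C ^ α₁ :=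
          Finset.sum_le_sum fun i _ => rpow_le_rpow (div_nonneg (hy i) hm0.le) (hyC i) hα₁.le
      _ = (n - 1) * C ^ α₁ := by
          rw [Finset.sum_const, Finset.card_erase_of_mem (mem_univ i₀), Finset.card_univ,
            nsmul_eq_mul, Nat.cast_sub (Fintype.card_pos_iff.2 ⟨i₀⟩), Nat.cast_one]
  have c1 : ContinuousAt (fun z : (ι → ℝ) × (ι → ℝ) => ∑ i, (z.2 i / m) ^ α₁) (x, y) :=
    tendsto_finsetSum _ fun i _ =>
      ContinuousAt.rpow (f := fun z : (ι → ℝ) × (ι → ℝ) => z.2 i / m) (by fun_prop) (by fun_prop)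
        (Or.inr hα₁)
  have p1 : ∀ᶠ z : (ι → ℝ) × (ι → ℝ) in 𝓝 (x, y), ∀ j, m < z.1 j :=
    eventually_all.2 fun j => continuousAt_const.eventually_lt (by fun_prop)
      (hm1.trans_le (hj₀ j (mem_univ j)))
  filter_upwards [c1.eventually (gt_mem_nhds hsum), p1] with z hz h1 h2
  have hw : ∀ i, 0 < (z.2 i / m) ^ α₁ := fun i => rpow_pos_of_pos (div_pos (h2 i) hm0) _
  have hlin : ∑ i, ((z.2 i / m) ^ α₁ - 1) < 0 := by
    rw [Finset.sum_sub_distrib]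
    simpa using hz
  have hlogw : ∑ i, log ((z.2 i / m) ^ α₁) < 0 :=
    (Finset.sum_le_sum fun i _ => log_le_sub_one_of_pos (hw i)).trans_lt hlin
  have hconst : ∀ a : ℝ, ∑ _i : ι, a = n * a := fun a => by simp [hn]
  have hscale : ∀ α, ∑ i, z.2 i ^ α = m ^ α * ∑ i, ((z.2 i / m) ^ α₁) ^ (α / α₁) := by
    intro α
    rw [Finset.mul_sum]
    refine Finset.sum_congr rfl fun i _ => ?_
    rw [← rpow_mul (div_pos (h2 i) hm0).le, mul_div_cancel₀ _ hα₁.ne',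
      div_rpow (h2 i).le hm0.le, mul_div_cancel₀ _ (rpow_pos_of_pos hm0 α).ne']
  refine ⟨?_, fun α hα => ⟨fun hneg => ?_, fun hpos _ => ?_, fun h => absurd h (by linarith)⟩⟩
  · have e : ∑ i, log ((z.2 i / m) ^ α₁) = α₁ * (∑ i, log (z.2 i) - n * log m) := by
      rw [← hconst, ← Finset.sum_sub_distrib, Finset.mul_sum]
      refine Finset.sum_congr rfl fun i _ => ?_
      rw [log_rpow (div_pos (h2 i) hm0), log_div (h2 i).ne' hm0.ne']
    rw [e] at hlogw
    have h3 : ∑ i, log (z.2 i) < n * log m := by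
      by_contra hcon
      have := mul_nonneg hα₁.le (sub_nonneg.2 (not_lt.1 hcon))
      linarith
    refine h3.trans_le ?_
    rw [← hconst]
    exact Finset.sum_le_sum fun i _ => log_le_log hm0 (h1 i).le
  · have h3 : n < ∑ i, ((z.2 i / m) ^ α₁) ^ (α / α₁) := by
      have t := sum_rpow_tangent_le hw 0 (α / α₁)
      simp only [rpow_zero, one_mul, sub_zero, hconst, mul_one] at t
      have := mul_pos_of_neg_of_neg (div_neg_of_neg_of_pos hneg hα₁) hlogw
      linarith
    calc ∑ i, z.1 i ^ α ≤ ∑ _i : ι, m ^ α :=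
          Finset.sum_le_sum fun i _ => rpow_le_rpow_of_nonpos hm0 (h1 i).le hneg.le
      _ = m ^ α * n := by rw [hconst, mul_comm]
      _ < _ := by
          rw [hscale]
          exact mul_lt_mul_of_pos_left h3 (rpow_pos_of_pos hm0 α)
  · have h3 : ∑ i, ((z.2 i / m) ^ α₁) ^ (α / α₁) < n := by
      have hs : 0 < α / α₁ := div_pos hpos hα₁
      have t : ∑ i, ((z.2 i / m) ^ α₁) ^ (α / α₁) ≤
          ∑ i, (1 + α / α₁ * ((z.2 i / m) ^ α₁ - 1)) := by
        refine Finset.sum_le_sum fun i _ => ?_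
        have := rpow_one_add_le_one_add_mul_self (s := (z.2 i / m) ^ α₁ - 1)
          (by linarith [hw i]) hs.le ((div_le_one hα₁).2 hα)
        rwa [add_sub_cancel] at this
      rw [Finset.sum_add_distrib, hconst, mul_one, ← Finset.mul_sum] at t
      have := mul_neg_of_pos_of_neg hs hlin
      linarith
    calc ∑ i, z.2 i ^ α < m ^ α * n := by
          rw [hscale]
          exact mul_lt_mul_of_pos_left h3 (rpow_pos_of_pos hm0 α)
      _ = ∑ _i : ι, m ^ α := by rw [hconst, mul_comm]
      _ ≤ _ := Finset.sum_le_sum fun i _ => rpow_le_rpow hm0.le (h1 i).le hpos.le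

lemma StrictRenyi.eventually_sign_at (h : StrictRenyi x y) {α₀ : ℝ} (hα₀ : 0 < α₀) :
    ∀ᶠ w : ((ι → ℝ) × (ι → ℝ)) × ℝ in 𝓝 ((x, y), α₀), (∀ i, 0 < w.1.2 i) →
      ∑ i, w.1.1 i = ∑ i, w.1.2 i → PowerSumSign w.2 w.1.1 w.1.2 := by
  rcases lt_trichotomy α₀ 1 with h1 | rfl | h1
  · exact (eventually_sign_of_mid hα₀ h1 (h.sign_of_pos α₀ hα₀)).mono fun w hw _ _ => hw
  · exact eventually_sign_one h.pos h.entropy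
  · exact (eventually_sign_of_one_lt h1 (h.sign_of_pos α₀ hα₀)).mono fun w hw _ _ => hw

lemma StrictRenyi.eventually_sign (h : StrictRenyi x y) :
    ∀ᶠ z : (ι → ℝ) × (ι → ℝ) in 𝓝 (x, y), (∀ i, 0 < z.2 i) → ∑ i, z.1 i = ∑ i, z.2 i →
      ∑ i, Real.log (z.2 i) < ∑ i, Real.log (z.1 i) ∧ ∀ α, PowerSumSign α z.1 z.2 := by
  obtain ⟨A, hA⟩ := eventually_sign_atTop h.pos h.exists_max
  have top : ∀ z : (ι → ℝ) × (ι → ℝ), (∀ α : ℝ, A ≤ α → ∑ i, z.1 i ^ α < ∑ i, z.2 i ^ α) →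
      ∀ α, max A 1 ≤ α → PowerSumSign α z.1 z.2 := by
    intro z hz α hα
    have h1 : 1 ≤ α := (le_max_right _ _).trans hα
    exact ⟨fun h => absurd h (by linarith), fun _ h => absurd h (by linarith),
      fun _ => hz α ((le_max_left _ _).trans hα)⟩
  by_cases hy : ∀ i, 0 < y i
  · obtain ⟨B, hB⟩ := eventually_sign_atBot h.nonneg h.exists_min
    have bot : ∀ z : (ι → ℝ) × (ι → ℝ), (∀ α, α ≤ B → ∑ i, z.1 i ^ α < ∑ i, z.2 i ^ α) →
        ∀ α, α ≤ min B 0 → PowerSumSign α z.1 z.2 := by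
      intro z hz α hα
      have h1 : α ≤ 0 := hα.trans (min_le_right _ _)
      exact ⟨fun _ => hz α (hα.trans (min_le_left _ _)), fun h => absurd h (by linarith),
        fun h => absurd h (by linarith)⟩
    have hK := (isCompact_Icc (a := min B 0) (b := max A 1)).eventually_forall_of_forall_eventually
      (x₀ := (x, y)) (P := fun z α => (∀ i, 0 < z.2 i) → ∑ i, z.1 i = ∑ i, z.2 i →
        PowerSumSign α z.1 z.2) fun α₀ _ => by
          rcases lt_trichotomy α₀ 0 with h0 | rfl | h0
          · exact (eventually_sign_of_neg h0 h.pos hy (h.sign hy α₀)).mono fun w hw _ _ => hw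
          · exact (eventually_sign_zero h.pos hy (h.log hy)).mono fun w hw _ _ => hw
          · exact h.eventually_sign_at h0
    have c1 : ContinuousAt (fun z : (ι → ℝ) × (ι → ℝ) => ∑ i, Real.log (z.1 i)) (x, y) :=
      tendsto_finsetSum _ fun i _ => ContinuousAt.log (by fun_prop) (h.pos i).ne'
    have c2 : ContinuousAt (fun z : (ι → ℝ) × (ι → ℝ) => ∑ i, Real.log (z.2 i)) (x, y) :=
      tendsto_finsetSum _ fun i _ => ContinuousAt.log (by fun_prop) (hy i).ne'
    filter_upwards [hA, hB, hK, c2.eventually_lt c1 (h.log hy)] with z h1 h2 h3 h4 hz hsum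
    refine ⟨h4, fun α => ?_⟩
    rcases le_total (max A 1) α with h5 | h5
    · exact top z (h1 hz) α h5
    rcases le_total α (min B 0) with h6 | h6
    · exact bot z (h2 hz) α h6
    · exact h3 α ⟨h6, h5⟩ hz hsum
  · have hzero : ∃ i, y i = 0 := by
      push Not at hy
      obtain ⟨i, hi⟩ := hy
      exact ⟨i, le_antisymm hi (h.nonneg i)⟩
    obtain ⟨α₁, hα₁, hB⟩ := eventually_sign_of_exists_zero h.pos h.nonneg hzero
    have hK := (isCompact_Icc (a := α₁) (b := max A 1)).eventually_forall_of_forall_eventually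
      (x₀ := (x, y)) (P := fun z α => (∀ i, 0 < z.2 i) → ∑ i, z.1 i = ∑ i, z.2 i →
        PowerSumSign α z.1 z.2) fun α₀ hα₀ => h.eventually_sign_at (hα₁.trans_le hα₀.1)
    filter_upwards [hA, hB, hK] with z h1 h2 h3 hz hsum
    refine ⟨(h2 hz).1, fun α => ?_⟩
    rcases le_total (max A 1) α with h5 | h5
    · exact top z (h1 hz) α h5
    rcases le_total α α₁ with h6 | h6
    · exact (h2 hz).2 α h6
    · exact h3 α ⟨h6, h5⟩ hz hsum

/-- The strict Rényi conditions are stable under perturbations with positive entries. -/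
lemma StrictRenyi.eventually (h : StrictRenyi x y) :
    ∀ᶠ z : (ι → ℝ) × (ι → ℝ) in 𝓝 (x, y), (∀ i, 0 < z.2 i) → ∑ i, z.1 i = ∑ i, z.2 i →
      StrictRenyi z.1 z.2 := by
  obtain ⟨i₁, hi₁⟩ := h.exists_max
  obtain ⟨i₂, hi₂⟩ := h.exists_min
  have p1 : ∀ᶠ z : (ι → ℝ) × (ι → ℝ) in 𝓝 (x, y), ∀ j, 0 < z.1 j :=
    eventually_all.2 fun j => continuousAt_const.eventually_lt (by fun_prop) (h.pos j)
  have p2 : ∀ᶠ z : (ι → ℝ) × (ι → ℝ) in 𝓝 (x, y), ∀ j, z.1 j < z.2 i₁ :=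
    eventually_all.2 fun j => ContinuousAt.eventually_lt (by fun_prop) (by fun_prop) (hi₁ j)
  have p3 : ∀ᶠ z : (ι → ℝ) × (ι → ℝ) in 𝓝 (x, y), ∀ j, z.2 i₂ < z.1 j :=
    eventually_all.2 fun j => ContinuousAt.eventually_lt (by fun_prop) (by fun_prop) (hi₂ j)
  have c1 : ContinuousAt (fun z : (ι → ℝ) × (ι → ℝ) => ∑ i, z.1 i * Real.log (z.1 i)) (x, y) :=
    tendsto_finsetSum _ fun i _ => continuous_mul_log.continuousAt.comp
      (f := fun z : (ι → ℝ) × (ι → ℝ) => z.1 i) (by fun_prop)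
  have c2 : ContinuousAt (fun z : (ι → ℝ) × (ι → ℝ) => ∑ i, z.2 i * Real.log (z.2 i)) (x, y) :=
    tendsto_finsetSum _ fun i _ => continuous_mul_log.continuousAt.comp
      (f := fun z : (ι → ℝ) × (ι → ℝ) => z.2 i) (by fun_prop)
  filter_upwards [p1, p2, p3, h.eventually_sign, c1.eventually_lt c2 h.entropy]
    with z h1 h2 h3 h4 h5 hz hsum
  obtain ⟨h6, h7⟩ := h4 hz hsum
  exact ⟨h1, fun i => (hz i).le, ⟨i₁, h2⟩, ⟨i₂, h3⟩, fun _ => h7, fun α _ => h7 α, h5, fun _ => h6⟩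

end Perturbation

section Mixing

open Real

variable {ι : Type*} [Fintype ι] {x y : ι → ℝ}

/-- The mixture of `x` with the uniform distribution, with weight `η` on the latter. -/
noncomputable def mixUniform (η : ℝ) (x : ι → ℝ) : ι → ℝ :=
  fun i => (1 - η) * x i + η * (1 / Fintype.card ι)

lemma IsProbVec.card_pos (hx : IsProbVec x) : (0 : ℝ) < Fintype.card ι := by
  rcases isEmpty_or_nonempty ι with h | h
  · simpa using hx.2
  · exact_mod_cast Fintype.card_pos

lemma IsProbVec.sum_uniform (hx : IsProbVec x) : ∑ _i : ι, 1 / (Fintype.card ι : ℝ) = 1 := by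
  simp [hx.card_pos.ne']

lemma IsProbVec.isProbVec_mixUniform (hx : IsProbVec x) {η : ℝ} (h0 : 0 ≤ η) (h1 : η ≤ 1) :
    IsProbVec (mixUniform η x) := by
  refine ⟨fun i => ?_, ?_⟩
  · have := mul_nonneg (sub_nonneg.2 h1) (hx.1 i)
    have := mul_nonneg h0 (one_div_nonneg.2 hx.card_pos.le)
    unfold mixUniform
    linarith
  · simp only [mixUniform]
    rw [Finset.sum_add_distrib, ← Finset.mul_sum, ← Finset.mul_sum, hx.2, hx.sum_uniform]
    ring

lemma IsProbVec.mixUniform_pos (hx : IsProbVec x) {η : ℝ} (h0 : 0 < η) (h1 : η ≤ 1) (i : ι) :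
    0 < mixUniform η x i := by
  have := mul_nonneg (sub_nonneg.2 h1) (hx.1 i)
  have := mul_pos h0 (one_div_pos.2 hx.card_pos)
  unfold mixUniform
  linarith

lemma IsProbVec.exists_uniform_lt (hx : IsProbVec x) (hne : ∃ i, x i ≠ 1 / Fintype.card ι) :
    ∃ i, 1 / (Fintype.card ι : ℝ) < x i := by
  by_contra! h
  obtain ⟨i, hi⟩ := hne
  have := Finset.sum_lt_sum (s := univ) (fun i _ => h i) ⟨i, mem_univ i, lt_of_le_of_ne (h i) hi⟩
  rw [hx.2, hx.sum_uniform] at this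
  exact lt_irrefl _ this

lemma IsProbVec.exists_lt_uniform (hx : IsProbVec x) (hne : ∃ i, x i ≠ 1 / Fintype.card ι) :
    ∃ i, x i < 1 / (Fintype.card ι : ℝ) := by
  by_contra! h
  obtain ⟨i, hi⟩ := hne
  have := Finset.sum_lt_sum (s := univ) (fun i _ => h i)
    ⟨i, mem_univ i, lt_of_le_of_ne (h i) hi.symm⟩
  rw [hx.2, hx.sum_uniform] at this
  exact lt_irrefl _ this

lemma IsProbVec.uniform_eq_sum (hx : IsProbVec x) :
    1 / (Fintype.card ι : ℝ) = ∑ i, 1 / (Fintype.card ι : ℝ) * x i := by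
  rw [← Finset.mul_sum, hx.2, mul_one]

lemma IsProbVec.card_mul_le (hx : IsProbVec x) {φ : ℝ → ℝ} {I : Set ℝ} (hφ : ConvexOn ℝ I φ)
    (hI : ∀ i, x i ∈ I) : ∑ _i : ι, φ (1 / Fintype.card ι) ≤ ∑ i, φ (x i) := by
  have h := hφ.map_sum_le (t := univ) (w := fun _ => 1 / (Fintype.card ι : ℝ)) (p := x)
    (fun i _ => one_div_nonneg.2 hx.card_pos.le) hx.sum_uniform fun i _ => hI i
  simp only [smul_eq_mul, ← hx.uniform_eq_sum, ← Finset.mul_sum] at h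
  rw [Finset.sum_const, Finset.card_univ, nsmul_eq_mul]
  rwa [one_div_mul_eq_div, le_div_iff₀' hx.card_pos] at h

lemma IsProbVec.sum_mixUniform_lt (hx : IsProbVec x) (hne : ∃ i, x i ≠ 1 / Fintype.card ι)
    {η : ℝ} (h0 : 0 < η) (h1 : η ≤ 1) {φ : ℝ → ℝ} {I : Set ℝ} (hφ : StrictConvexOn ℝ I φ)
    (hI : ∀ i, x i ∈ I) : ∑ i, φ (mixUniform η x i) < ∑ i, φ (x i) := by
  have hu : 1 / (Fintype.card ι : ℝ) ∈ I := by
    rw [hx.uniform_eq_sum]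
    exact hφ.1.sum_mem (fun i _ => one_div_nonneg.2 hx.card_pos.le) hx.sum_uniform fun i _ => hI i
  obtain ⟨i, hi⟩ := hx.exists_uniform_lt hne
  obtain ⟨j, hj⟩ := hx.exists_lt_uniform hne
  have hlt : ∑ _i : ι, φ (1 / Fintype.card ι) < ∑ i, φ (x i) := by
    have h := hφ.map_sum_lt (t := univ) (w := fun _ => 1 / (Fintype.card ι : ℝ)) (p := x)
      (fun i _ => one_div_pos.2 hx.card_pos) hx.sum_uniform (fun i _ => hI i)
      ⟨i, mem_univ i, j, mem_univ j, (hj.trans hi).ne'⟩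
    simp only [smul_eq_mul, ← hx.uniform_eq_sum, ← Finset.mul_sum] at h
    rw [Finset.sum_const, Finset.card_univ, nsmul_eq_mul]
    rwa [one_div_mul_eq_div, lt_div_iff₀' hx.card_pos] at h
  have hle : ∑ i, φ (mixUniform η x i) ≤
      ∑ i, ((1 - η) * φ (x i) + η * φ (1 / Fintype.card ι)) :=
    Finset.sum_le_sum fun i _ =>
      hφ.convexOn.2 (hI i) hu (sub_nonneg.2 h1) h0.le (sub_add_cancel 1 η)
  rw [Finset.sum_add_distrib, ← Finset.mul_sum, ← Finset.mul_sum] at hle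
  nlinarith [mul_lt_mul_of_pos_left hlt h0]

lemma exists_le_of_sum_rpow_le (hx : ∀ i, 0 ≤ x i) (hy : ∀ i, 0 ≤ y i)
    (h : ∀ α : ℝ, 1 < α → ∑ i, x i ^ α ≤ ∑ i, y i ^ α) (i : ι) : ∃ j, x i ≤ y j := by
  by_contra! hlt
  obtain ⟨j₀, -, hj₀⟩ := Finset.exists_max_image univ y ⟨i, mem_univ i⟩
  obtain ⟨c, hc1, hc2⟩ := exists_between (hlt j₀)
  have hc0 : 0 < c := (hy j₀).trans_lt hc1
  obtain ⟨A, hA⟩ := exists_forall_ge_card_lt_rpow ((one_lt_div hc0).2 hc2) (Fintype.card ι)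
  have hα : 1 < max A 2 := lt_max_of_lt_right one_lt_two
  have h1 := hA _ (le_max_left A 2)
  have h2 := h _ hα
  set α := max A 2
  rw [div_rpow (hx i) hc0.le, lt_div_iff₀ (rpow_pos_of_pos hc0 α)] at h1
  have h3 : ∑ j, y j ^ α ≤ ∑ _j : ι, c ^ α :=
    Finset.sum_le_sum fun j _ => rpow_le_rpow (hy j) ((hj₀ j (mem_univ j)).trans hc1.le)
      (by linarith)
  rw [Finset.sum_const, Finset.card_univ, nsmul_eq_mul] at h3
  have h4 := Finset.single_le_sum (f := fun i => x i ^ α) (fun i _ => rpow_nonneg (hx i) α)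
    (mem_univ i)
  linarith

lemma RenyiLE.exists_ge (h : RenyiLE x y) (hy : ∀ i, 0 < y i) (i : ι) : ∃ j, y j ≤ x i := by
  have hx := h.pos hy
  obtain ⟨j, hj⟩ := exists_le_of_sum_rpow_le (x := fun i => (x i)⁻¹) (y := fun i => (y i)⁻¹)
    (fun i => (inv_pos.2 (hx i)).le) (fun i => (inv_pos.2 (hy i)).le) (fun α hα => by
      simpa only [inv_rpow (hx _).le, inv_rpow (hy _).le, ← rpow_neg (hx _).le,
        ← rpow_neg (hy _).le] using h.neg hy (-α) (by linarith)) i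
  exact ⟨j, (inv_le_inv₀ (hx i) (hy j)).1 hj⟩

/-- Mixing a nonuniform `x` with the uniform distribution turns `RenyiLE x y` into its strict
version. -/
lemma RenyiLE.strictRenyi_mixUniform (h : RenyiLE x y) (hx : IsProbVec x) (hy : IsProbVec y)
    (hne : ∃ i, x i ≠ 1 / Fintype.card ι) {η : ℝ} (h0 : 0 < η) (h1 : η < 1) :
    StrictRenyi (mixUniform η x) y := by
  have hpos := fun i => hx.mixUniform_pos h0 h1.le i
  have hs : ∀ α : ℝ, 0 < α → PowerSumSign α (mixUniform η x) y := fun α hα =>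
    { neg := fun h => absurd h (not_lt.2 hα.le)
      mid := fun _ hα1 => by
        have := hx.sum_mixUniform_lt hne h0 h1.le (strictConcaveOn_rpow hα hα1).neg hx.1
        simp only [Pi.neg_apply, Finset.sum_neg_distrib, neg_lt_neg_iff] at this
        exact (h.lt_one α hα hα1).trans_lt this
      one_lt := fun hα1 =>
        (hx.sum_mixUniform_lt hne h0 h1.le (strictConvexOn_rpow hα1) hx.1).trans_le
          (h.one_lt α hα1) }
  refine
    { pos := hpos
      nonneg := hy.1
      exists_max := ?_
      exists_min := ?_
      sign := fun hy0 α => ?_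
      sign_of_pos := hs
      entropy := (hx.sum_mixUniform_lt hne h0 h1.le strictConvexOn_mul_log hx.1).trans_le h.entropy
      log := fun hy0 => ?_ }
  · obtain ⟨i, hi⟩ := hx.exists_uniform_lt hne
    obtain ⟨k, -, hk⟩ := Finset.exists_max_image univ x ⟨i, mem_univ i⟩
    obtain ⟨j, hj⟩ := exists_le_of_sum_rpow_le hx.1 hy.1 h.one_lt k
    refine ⟨j, fun l => lt_of_lt_of_le ?_ hj⟩
    have := mul_le_mul_of_nonneg_left (hk l (mem_univ l)) (sub_nonneg.2 h1.le)
    have := mul_lt_mul_of_pos_left (hi.trans_le (hk i (mem_univ i))) h0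
    unfold mixUniform
    linarith
  · by_cases hy0 : ∀ i, 0 < y i
    · obtain ⟨i, hi⟩ := hx.exists_lt_uniform hne
      obtain ⟨k, -, hk⟩ := Finset.exists_min_image univ x ⟨i, mem_univ i⟩
      obtain ⟨j, hj⟩ := h.exists_ge hy0 k
      refine ⟨j, fun l => lt_of_le_of_lt hj ?_⟩
      have := mul_le_mul_of_nonneg_left (hk l (mem_univ l)) (sub_nonneg.2 h1.le)
      have := mul_lt_mul_of_pos_left ((hk i (mem_univ i)).trans_lt hi) h0
      unfold mixUniform
      linarith
    · push Not at hy0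
      obtain ⟨j, hj⟩ := hy0
      exact ⟨j, fun l => hj.trans_lt (hpos l)⟩
  · rcases lt_or_ge 0 α with hα | hα
    · exact hs α hα
    · exact
        { neg := fun hα => (hx.sum_mixUniform_lt hne h0 h1.le (strictConvexOn_rpow_of_neg hα)
            (h.pos hy0)).trans_le (h.neg hy0 α hα)
          mid := fun h => absurd h (not_lt.2 hα)
          one_lt := fun h => absurd h (by linarith) }
  · have := hx.sum_mixUniform_lt hne h0 h1.le strictConcaveOn_log_Ioi.neg (h.pos hy0)
    simp only [Pi.neg_apply, Finset.sum_neg_distrib, neg_lt_neg_iff] at this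
    exact (h.log hy0).trans_lt this

end Mixing

section Slack

open Real Filter Topology

variable {ι κ : Type*} [Fintype ι] [Fintype κ] {x y z : ι → ℝ} {r : κ → ℝ}

/-- Every vector close enough to a mixture of `y` with the uniform distribution is the image of `y`
under a doubly stochastic matrix. -/
lemma IsProbVec.eventually_hinge_le (hy : IsProbVec y) (hne : ∃ i, y i ≠ 1 / Fintype.card ι)
    {η : ℝ} (h0 : 0 < η) (h1 : η ≤ 1) :
    ∀ᶠ z in 𝓝 (mixUniform η y), ∑ i, z i = 1 →
      ∀ t, ∑ i, max (z i - t) 0 ≤ ∑ i, max (y i - t) 0 := by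
  classical
  set n : ℝ := (Fintype.card ι : ℝ) with hn
  have hn0 : 0 < n := hy.card_pos
  set S : ℝ := ∑ j, (y j - 1 / n) ^ 2 with hS
  have hS0 : 0 < S := by
    obtain ⟨i, hi⟩ := hne
    exact Finset.sum_pos' (fun j _ => sq_nonneg _) ⟨i, mem_univ i, by
      have := sub_ne_zero.2 hi
      positivity⟩
  have hcent : ∑ j, (y j - 1 / n) = 0 := by
    rw [Finset.sum_sub_distrib, hy.2, hy.sum_uniform, sub_self]
  have hS' : ∑ j, (y j - 1 / n) * y j = S := by
    have : S = ∑ j, (y j - 1 / n) * y j - 1 / n * ∑ j, (y j - 1 / n) := by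
      rw [hS, Finset.mul_sum, ← Finset.sum_sub_distrib]
      exact Finset.sum_congr rfl fun j _ => by ring
    rw [this, hcent, mul_zero, sub_zero]
  have hle : ∀ j, |y j - 1 / n| ≤ 1 := by
    intro j
    have h2 : y j ≤ 1 := hy.2 ▸ Finset.single_le_sum (fun i _ => hy.1 i) (mem_univ j)
    have h3 : 1 / n ≤ 1 :=
      (Finset.single_le_sum (f := fun _ => 1 / n) (fun i _ => by positivity)
        (mem_univ j)).trans_eq hy.sum_uniform
    have h4 : 0 ≤ 1 / n := by positivity
    rw [abs_le]
    constructor <;> linarith [hy.1 j]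
  have hsmall : ∀ᶠ z in 𝓝 (mixUniform η y),
      ∀ i, |z i - mixUniform η y i| < η * (1 / n) * S := by
    refine eventually_all.2 fun i => ContinuousAt.eventually_lt
      ((continuous_apply i).sub continuous_const).abs.continuousAt continuousAt_const ?_
    rw [sub_self, abs_zero]
    positivity
  filter_upwards [hsmall] with z hz hsum t
  set e : ι → ℝ := fun i => z i - mixUniform η y i with he
  have hesum : ∑ i, e i = 0 := by
    rw [he, Finset.sum_sub_distrib, hsum, (hy.isProbVec_mixUniform h0.le h1).2, sub_self]
  set T : ι → ι → ℝ := fun i j =>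
    (if i = j then 1 - η else 0) + η * (1 / n) + e i * ((y j - 1 / n) / S) with hT
  have hT0 : ∀ i j, 0 ≤ T i j := by
    intro i j
    have t1 : 0 ≤ if i = j then 1 - η else 0 := by split_ifs <;> linarith
    have t2 : |e i * ((y j - 1 / n) / S)| ≤ η * (1 / n) := by
      rw [abs_mul, abs_div, abs_of_pos hS0, ← mul_div_assoc, div_le_iff₀ hS0]
      calc |e i| * |y j - 1 / n| ≤ |e i| * 1 :=
            mul_le_mul_of_nonneg_left (hle j) (abs_nonneg _)
        _ ≤ _ := by rw [mul_one]; exact (hz i).le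
    have := (abs_le.1 t2).1
    simp only [hT]
    linarith
  have hunif : ∑ _j : ι, η * (1 / n) = η := by
    rw [← Finset.mul_sum, hy.sum_uniform, mul_one]
  have hrow : ∀ i, ∑ j, T i j = 1 := by
    intro i
    simp only [hT]
    rw [Finset.sum_add_distrib, Finset.sum_add_distrib, hunif, ← Finset.mul_sum,
      ← Finset.sum_div, hcent, Finset.sum_ite_eq, if_pos (mem_univ i)]
    ring
  have hcol : ∀ j, ∑ i, T i j = 1 := by
    intro j
    simp only [hT]
    rw [Finset.sum_add_distrib, Finset.sum_add_distrib, hunif, ← Finset.sum_mul, hesum,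
      Finset.sum_ite_eq', if_pos (mem_univ j)]
    ring
  have happ : ∀ i, ∑ j, T i j * y j = z i := by
    intro i
    have : ∀ j, T i j * y j = (if i = j then (1 - η) * y j else 0) + η * (1 / n) * y j +
        e i / S * ((y j - 1 / n) * y j) := by
      intro j
      simp only [hT]
      split_ifs <;> ring
    simp only [this, Finset.sum_add_distrib, ← Finset.mul_sum, hS', hy.2]
    rw [Finset.sum_ite_eq, if_pos (mem_univ i), div_mul_cancel₀ _ hS0.ne']
    simp only [he, mixUniform]
    ring
  have hbound : ∀ i, max (z i - t) 0 ≤ ∑ j, T i j * max (y j - t) 0 := by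
    intro i
    refine max_le ?_ (Finset.sum_nonneg fun j _ => mul_nonneg (hT0 i j) (le_max_right _ _))
    have : z i - t = ∑ j, T i j * (y j - t) := by
      simp only [mul_sub, Finset.sum_sub_distrib, ← Finset.sum_mul, hrow, happ, one_mul]
    rw [this]
    exact Finset.sum_le_sum fun j _ => mul_le_mul_of_nonneg_left (le_max_left _ _) (hT0 i j)
  calc ∑ i, max (z i - t) 0 ≤ ∑ i, ∑ j, T i j * max (y j - t) 0 :=
        Finset.sum_le_sum fun i _ => hbound i
    _ = ∑ j, (∑ i, T i j) * max (y j - t) 0 := by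
        rw [Finset.sum_comm]
        simp only [Finset.sum_mul]
    _ = _ := by simp only [hcol, one_mul]

lemma hinge_tensor_le (hr : ∀ j, 0 ≤ r j)
    (h : ∀ t, ∑ i, max (x i - t) 0 ≤ ∑ i, max (y i - t) 0) (t : ℝ) :
    ∑ w, max (tensor x r w - t) 0 ≤ ∑ w, max (tensor y r w - t) 0 := by
  rw [sum_tensor x r fun w => max (w - t) 0, sum_tensor y r fun w => max (w - t) 0]
  refine Finset.sum_le_sum fun j _ => ?_
  rcases (hr j).eq_or_lt with h0 | h0
  · simp [← h0]
  · have e : ∀ v : ℝ, max (v * r j - t) 0 = max (v - t / r j) 0 * r j := by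
      intro v
      rw [max_mul_of_nonneg _ _ h0.le, sub_mul, div_mul_cancel₀ _ h0.ne', zero_mul]
    simp only [e, ← Finset.sum_mul]
    exact mul_le_mul_of_nonneg_right (h _) h0.le

lemma Maj.tensor_trans (hr : ∀ j, 0 ≤ r j) (hmaj : Maj (tensor z r) (tensor x r))
    (hsum : ∑ i, x i = ∑ i, y i)
    (h : ∀ t, ∑ i, max (x i - t) 0 ≤ ∑ i, max (y i - t) 0) :
    Maj (tensor z r) (tensor y r) := by
  refine maj_of_hinge_le (hmaj.1.trans ?_) fun t =>
    (hmaj.hinge_le t).trans (hinge_tensor_le hr h t)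
  have e : ∀ v : ι → ℝ, ∑ w, tensor v r w = (∑ i, v i) * ∑ j, r j := fun v => by
    have := sum_tensor v r id
    simp only [id, ← Finset.sum_mul, ← Finset.mul_sum] at this
    exact this
  rw [e, e, hsum]

end Slack

section Grid

open Real Filter Topology

variable {ι : Type*} [Fintype ι] {x y : ι → ℝ}

lemma tendsto_floor_mul_div (L : ℝ) :
    Tendsto (fun M : ℕ => (⌊(M : ℝ) * L⌋ : ℝ) / M) atTop (𝓝 L) := by
  have h1 : Tendsto (fun M : ℕ => L - 1 / (M : ℝ)) atTop (𝓝 L) := by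
    simpa using tendsto_const_nhds.sub (tendsto_one_div_atTop_nhds_zero_nat (𝕜 := ℝ))
  refine tendsto_of_tendsto_of_tendsto_of_le_of_le' h1 tendsto_const_nhds ?_ ?_
  · filter_upwards [eventually_gt_atTop 0] with M hM
    have hM0 : (0 : ℝ) < M := by exact_mod_cast hM
    rw [le_div_iff₀ hM0, sub_mul, one_div_mul_cancel hM0.ne']
    linarith [Int.sub_one_lt_floor ((M : ℝ) * L)]
  · filter_upwards [eventually_gt_atTop 0] with M hM
    have hM0 : (0 : ℝ) < M := by exact_mod_cast hM
    rw [div_le_iff₀ hM0]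
    linarith [Int.floor_le ((M : ℝ) * L)]

/-- A pair of distributions satisfying the strict conditions can be approximated by pairs whose
entries are integer powers of a common base, up to a common factor. -/
lemma StrictRenyi.exists_grid (h : StrictRenyi x y) (hy : ∀ i, 0 < y i) (hx1 : ∑ i, x i = 1)
    {U : Set ((ι → ℝ) × (ι → ℝ))} (hU : U ∈ 𝓝 (x, y)) :
    ∃ z ∈ U, ∑ i, z.1 i = 1 ∧ ∑ i, z.2 i = 1 ∧ ∃ ω c : ℝ, 1 < ω ∧ 0 < c ∧ ∃ a b : ι → ℤ,
      (∀ i, z.1 i = c * ω ^ a i) ∧ ∀ i, z.2 i = c * ω ^ b i := by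
  have hx := h.pos
  have hne : (univ : Finset ι).Nonempty := by
    rw [Finset.nonempty_iff_ne_empty]
    rintro he
    simp [he] at hx1
  set W : ℝ → (ι → ℝ) → ℝ := fun s u => ∑ i, exp (s * u i) with hW
  have hW0 : ∀ s u, 0 < W s u := fun s u => Finset.sum_pos (fun i _ => exp_pos _) hne
  have hWc : Continuous fun w : ℝ × (ι → ℝ) => W w.1 w.2 := by
    simp only [hW]
    fun_prop
  set F : ℝ × ((ι → ℝ) × (ι → ℝ)) → (ι → ℝ) × (ι → ℝ) := fun w =>
    (fun i => exp (w.1 * w.2.1 i) / W w.1 w.2.1, fun i => exp (w.1 * w.2.2 i) / W w.1 w.2.1)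
    with hF
  have hFc : Continuous F := by
    have h3 : Continuous fun w : ℝ × ((ι → ℝ) × (ι → ℝ)) => W w.1 w.2.1 :=
      hWc.comp (f := fun w : ℝ × ((ι → ℝ) × (ι → ℝ)) => (w.1, w.2.1)) (by fun_prop)
    refine Continuous.prodMk (continuous_pi fun i => ?_) (continuous_pi fun i => ?_) <;>
      exact Continuous.div (by fun_prop) h3 fun w => (hW0 _ _).ne'
  set lx : ι → ℝ := fun i => Real.log (x i) with hlx
  set ly : ι → ℝ := fun i => Real.log (y i) with hly
  have hWx : ∀ s, W s lx = ∑ i, x i ^ s := fun s =>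
    Finset.sum_congr rfl fun i _ => by rw [rpow_def_of_pos (hx i), mul_comm]
  have hWy : ∀ s, W s ly = ∑ i, y i ^ s := fun s =>
    Finset.sum_congr rfl fun i _ => by rw [rpow_def_of_pos (hy i), mul_comm]
  have hF1 : F (1, (lx, ly)) = (x, y) := by
    have : W 1 lx = 1 := by simp [hWx, hx1]
    refine Prod.ext (funext fun i => ?_) (funext fun i => ?_)
    · change exp (1 * lx i) / W 1 lx = x i
      rw [this, div_one, one_mul, exp_log (hx i)]
    · change exp (1 * ly i) / W 1 lx = y i
      rw [this, div_one, one_mul, exp_log (hy i)]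
  have hev : ∀ᶠ w in 𝓝 (1 : ℝ) ×ˢ 𝓝 (lx, ly), F w ∈ U := by
    rw [← nhds_prod_eq]
    exact hFc.continuousAt.eventually (hF1 ▸ hU)
  obtain ⟨P, hP, Q, hQ, hPQ⟩ := eventually_prod_iff.1 hev
  obtain ⟨δ₀, hδ₀, hδP⟩ := Metric.eventually_nhds_iff.1 hP
  obtain ⟨δ, hδ, hδ1⟩ := exists_between (lt_min hδ₀ one_pos)
  have hδδ₀ := hδ1.trans_le (min_le_left _ _)
  replace hδ1 := hδ1.trans_le (min_le_right _ _)
  have hWc1 : ∀ s, Continuous fun u => W s u := fun s => by simp only [hW]; fun_prop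
  have hlow : ∀ᶠ w in 𝓝 (lx, ly), W (1 - δ) w.2 < W (1 - δ) w.1 := by
    refine ContinuousAt.eventually_lt ((hWc1 _).comp continuous_snd).continuousAt
      ((hWc1 _).comp continuous_fst).continuousAt ?_
    simp only [hWx, hWy]
    exact (h.sign_of_pos _ (by linarith)).mid (by linarith) (by linarith)
  have hhigh : ∀ᶠ w in 𝓝 (lx, ly), W (1 + δ) w.1 < W (1 + δ) w.2 := by
    refine ContinuousAt.eventually_lt ((hWc1 _).comp continuous_fst).continuousAt
      ((hWc1 _).comp continuous_snd).continuousAt ?_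
    simp only [hWx, hWy]
    exact (h.sign_of_pos _ (by linarith)).one_lt (by linarith)
  have hlim : Tendsto (fun M : ℕ => ((fun i => (⌊(M : ℝ) * lx i⌋ : ℝ) / M : ι → ℝ),
      (fun i => (⌊(M : ℝ) * ly i⌋ : ℝ) / M : ι → ℝ))) atTop (𝓝 (lx, ly)) := by
    rw [nhds_prod_eq]
    exact (tendsto_pi_nhds.2 fun i => tendsto_floor_mul_div _).prodMk
      (tendsto_pi_nhds.2 fun i => tendsto_floor_mul_div _)
  obtain ⟨M, ⟨⟨hMQ, hMl⟩, hMh⟩, hM⟩ :=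
    (((hlim.eventually hQ).and (hlim.eventually hlow)).and (hlim.eventually hhigh)).and
      (eventually_gt_atTop 0) |>.exists
  have hM0 : (0 : ℝ) < M := by exact_mod_cast hM
  set u : ι → ℝ := fun i => (⌊(M : ℝ) * lx i⌋ : ℝ) / M with hu
  set v : ι → ℝ := fun i => (⌊(M : ℝ) * ly i⌋ : ℝ) / M with hv
  obtain ⟨s, hs, hs0⟩ : (0 : ℝ) ∈ (fun s => W s v - W s u) '' Set.Icc (1 - δ) (1 + δ) := by
    refine intermediate_value_Icc (by linarith) (Continuous.continuousOn ?_)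
      ⟨(sub_neg.2 hMl).le, (sub_pos.2 hMh).le⟩
    simp only [hW]
    fun_prop
  have hsP : P s := hδP (by rw [Real.dist_eq, abs_lt]; constructor <;> linarith [hs.1, hs.2])
  have hsW : W s v = W s u := sub_eq_zero.1 hs0
  have hspos : 0 < s := by linarith [hs.1]
  have hpow : ∀ k : ℤ, exp (s / M) ^ k = exp (s * (k / M)) := by
    intro k
    rw [← rpow_intCast, ← exp_mul]
    congr 1
    ring
  refine ⟨F (s, (u, v)), hPQ hsP hMQ, ?_, ?_, exp (s / M), (W s u)⁻¹,
    one_lt_exp_iff.2 (div_pos hspos hM0), inv_pos.2 (hW0 s u), fun i => ⌊(M : ℝ) * lx i⌋,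
    fun i => ⌊(M : ℝ) * ly i⌋, fun i => ?_, fun i => ?_⟩
  · simp only [hF]
    rw [← Finset.sum_div]
    exact div_self (hW0 s u).ne'
  · simp only [hF]
    rw [← Finset.sum_div, ← hsW]
    exact div_self (hW0 s v).ne'
  · rw [hpow, mul_comm, ← div_eq_mul_inv]
  · rw [hpow, mul_comm, ← div_eq_mul_inv]

lemma sum_pow_eq_sum_rpow_div {ω c : ℝ} (hω : 1 < ω) (hc : 0 < c) {a : ι → ℕ}
    (hx : ∀ i, x i = c * ω ^ a i) {X : ℝ} (hX : 0 < X) :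
    ∑ i, X ^ a i = (∑ i, x i ^ logb ω X) / c ^ logb ω X := by
  have hω0 : 0 < ω := by linarith
  rw [Finset.sum_div]
  refine Finset.sum_congr rfl fun i _ => ?_
  rw [hx i, mul_rpow hc.le (pow_pos hω0 _).le, mul_div_cancel_left₀ _ (rpow_pos_of_pos hc _).ne',
    ← rpow_natCast ω, ← rpow_mul hω0.le, mul_comm, rpow_mul hω0.le,
    rpow_logb hω0 hω.ne' hX, rpow_natCast]

/-- Strict conditions on a grid produce a catalyst. -/
lemma StrictRenyi.exists_catalyst (h : StrictRenyi x y) (hsum : ∑ i, x i = ∑ i, y i) {ω c : ℝ}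
    (hω : 1 < ω) (hc : 0 < c) {a b : ι → ℤ} (hx : ∀ i, x i = c * ω ^ a i)
    (hy : ∀ i, y i = c * ω ^ b i) :
    ∃ m : ℕ, 1 ≤ m ∧ ∃ r : Fin m → ℝ, IsProbVec r ∧ Maj (tensor x r) (tensor y r) := by
  have hω0 : 0 < ω := by linarith
  obtain ⟨i₀, hi₀⟩ := h.exists_min
  obtain ⟨k, -, hk⟩ := Finset.exists_min_image univ b ⟨i₀, mem_univ i₀⟩
  have hlt : ∀ j, b k < a j := by
    intro j
    refine (hk i₀ (mem_univ _)).trans_lt ?_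
    have := hi₀ j
    rw [hx, hy] at this
    exact (zpow_lt_zpow_iff_right₀ hω).1 (lt_of_mul_lt_mul_left this hc.le)
  set c' : ℝ := c * ω ^ b k with hc'
  have hc'0 : 0 < c' := mul_pos hc (zpow_pos hω0 _)
  have hshift : ∀ l : ℤ, b k ≤ l → c * ω ^ l = c' * ω ^ (l - b k).toNat := by
    intro l hl
    rw [hc', mul_assoc, ← zpow_natCast ω, Int.toNat_of_nonneg (sub_nonneg.2 hl),
      ← zpow_add₀ hω0.ne', add_sub_cancel]
  have hx' : ∀ i, x i = c' * ω ^ (a i - b k).toNat := fun i => (hx i).trans (hshift _ (hlt i).le)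
  have hy' : ∀ i, y i = c' * ω ^ (b i - b k).toNat :=
    fun i => (hy i).trans (hshift _ (hk i (mem_univ i)))
  have hypos : ∀ i, 0 < y i := fun i => by rw [hy i]; exact mul_pos hc (zpow_pos hω0 _)
  have hlog : ∀ l : ℕ, Real.log (c' * ω ^ l) = Real.log c' + l * Real.log ω := fun l => by
    rw [Real.log_mul hc'0.ne' (pow_pos hω0 _).ne', Real.log_pow]
  have hlogω : 0 < Real.log ω := Real.log_pos hω
  have hs := h.sign hypos
  refine exists_catalyst_of_grid hω hc'0 hx' hy' hsum
    (fun i => by have := hlt i; omega) ⟨k, by simp⟩ ?_ ?_ ?_ ?_ ?_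
  · intro X hX0 hX1
    rw [sum_pow_eq_sum_rpow_div hω hc'0 hx' hX0, sum_pow_eq_sum_rpow_div hω hc'0 hy' hX0]
    exact div_lt_div_of_pos_right ((hs _).neg (logb_neg hω hX0 hX1)) (rpow_pos_of_pos hc'0 _)
  · intro X hX1 hXω
    have hX0 : 0 < X := by linarith
    rw [sum_pow_eq_sum_rpow_div hω hc'0 hx' hX0, sum_pow_eq_sum_rpow_div hω hc'0 hy' hX0]
    refine div_lt_div_of_pos_right ((hs _).mid (logb_pos hω hX1) ?_) (rpow_pos_of_pos hc'0 _)
    rwa [logb_lt_iff_lt_rpow hω hX0, rpow_one]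
  · intro X hXω
    have hX0 : 0 < X := by linarith
    rw [sum_pow_eq_sum_rpow_div hω hc'0 hx' hX0, sum_pow_eq_sum_rpow_div hω hc'0 hy' hX0]
    refine div_lt_div_of_pos_right ((hs _).one_lt ?_) (rpow_pos_of_pos hc'0 _)
    rwa [lt_logb_iff_rpow_lt hω hX0, rpow_one]
  · have := h.log hypos
    simp only [hx', hy', hlog, Finset.sum_add_distrib, ← Finset.sum_mul] at this
    exact lt_of_mul_lt_mul_right (lt_of_add_lt_add_left this) hlogω.le
  · have he := h.entropy
    have e : ∀ (z : ι → ℝ) (l : ι → ℕ), (∀ i, z i = c' * ω ^ l i) →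
        ∑ i, z i * Real.log (z i) =
          (∑ i, z i) * Real.log c' + c' * Real.log ω * ∑ i, (l i : ℝ) * ω ^ l i := by
      intro z l hz
      rw [Finset.sum_mul, Finset.mul_sum, ← Finset.sum_add_distrib]
      refine Finset.sum_congr rfl fun i _ => ?_
      rw [hz i, hlog]
      ring
    rw [e x _ hx', e y _ hy', hsum] at he
    exact lt_of_mul_lt_mul_left (lt_of_add_lt_add_left he) (mul_pos hc'0 hlogω).le

end Grid

section Main

open Real Filter Topology

lemma tendsto_mixUniform {ι : Type*} [Fintype ι] (x : ι → ℝ) :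
    Tendsto (fun η => mixUniform η x) (𝓝[>] 0) (𝓝 x) := by
  have hc : Continuous fun η : ℝ => mixUniform η x := by
    unfold mixUniform
    fun_prop
  have h := hc.tendsto 0
  have e : mixUniform 0 x = x := by
    funext i
    simp [mixUniform]
  rw [e] at h
  exact h.mono_left nhdsWithin_le_nhds

lemma sum_abs_sub_eventually_lt {ι : Type*} [Fintype ι] (x : ι → ℝ) {ε : ℝ} (hε : 0 < ε) :
    ∀ᶠ z in 𝓝 x, ∑ i, |z i - x i| < ε := by
  have hc : Continuous fun z : ι → ℝ => ∑ i, |z i - x i| :=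
    continuous_finsetSum _ fun i _ => ((continuous_apply i).sub continuous_const).abs
  refine hc.continuousAt.eventually_lt continuousAt_const ?_
  simpa using hε

/-- If `x` satisfies the strict conditions relative to `y`, then distributions arbitrarily close to
`x` are catalytically majorized by `y`. -/
lemma StrictRenyi.exists_near {ι : Type*} [Fintype ι] {x y : ι → ℝ} (h : StrictRenyi x y)
    (hx : IsProbVec x) (hy : IsProbVec y) {V : Set (ι → ℝ)} (hV : V ∈ 𝓝 x) :
    ∃ z ∈ V, IsProbVec z ∧ ∃ m : ℕ, 1 ≤ m ∧ ∃ r : Fin m → ℝ, IsProbVec r ∧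
      Maj (tensor z r) (tensor y r) := by
  have hne : ∃ i, y i ≠ 1 / Fintype.card ι := by
    by_contra! hcon
    obtain ⟨i, hi⟩ := h.exists_max
    have := Finset.sum_lt_sum_of_nonempty ⟨i, mem_univ i⟩ fun j _ => hi j
    rw [hx.2, hcon i, hx.sum_uniform] at this
    exact lt_irrefl _ this
  have hη : ∀ᶠ η in 𝓝[>] (0 : ℝ), (∀ᶠ z in 𝓝 (x, mixUniform η y), (∀ i, 0 < z.2 i) →
      ∑ i, z.1 i = ∑ i, z.2 i → StrictRenyi z.1 z.2) ∧ η ∈ Set.Ioo (0 : ℝ) 1 :=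
    ((tendsto_const_nhds.prodMk_nhds (tendsto_mixUniform y)).eventually
      h.eventually.eventually_nhds).and (Ioo_mem_nhdsGT one_pos)
  obtain ⟨η, hη, h0, h1⟩ := hη.exists
  have hyη := hy.isProbVec_mixUniform h0.le h1.le
  have hpos := fun i => hy.mixUniform_pos h0 h1.le i
  have hst : StrictRenyi x (mixUniform η y) := hη.self_of_nhds hpos (hx.2.trans hyη.2.symm)
  have hmaj : ∀ᶠ z in 𝓝 (x, mixUniform η y), ∑ i, z.2 i = 1 →
      ∀ t, ∑ i, max (z.2 i - t) 0 ≤ ∑ i, max (y i - t) 0 :=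
    (continuous_snd.tendsto (x, mixUniform η y)).eventually
      (hy.eventually_hinge_le hne h0 h1.le)
  have hVx : ∀ᶠ z in 𝓝 (x, mixUniform η y), z.1 ∈ V := continuousAt_fst.eventually hV
  obtain ⟨z, ⟨⟨hz1, hz2⟩, hz3⟩, hs1, hs2, ω, c, hω, hc, a, b, ha, hb⟩ :=
    hst.exists_grid hpos hx.2 ((hη.and hmaj).and hVx)
  have hzpos : ∀ i, 0 < z.2 i := fun i => by
    rw [hb]
    exact mul_pos hc (zpow_pos (by linarith) _)
  have hz := hz1 hzpos (hs1.trans hs2.symm)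
  obtain ⟨m, hm, r, hr, hmr⟩ := hz.exists_catalyst (hs1.trans hs2.symm) hω hc ha hb
  exact ⟨z.1, hz3, ⟨fun i => (hz.pos i).le, hs1⟩, m, hm, r, hr,
    hmr.tensor_trans hr.1 (hs2.trans hy.2.symm) (hz2 hs2)⟩

lemma maj_of_eq_uniform {ι : Type*} [Fintype ι] {x y : ι → ℝ} (hx : IsProbVec x)
    (hy : IsProbVec y) (h : ∀ i, x i = 1 / Fintype.card ι) :
    Maj (tensor x fun _ : Fin 1 => 1) (tensor y fun _ : Fin 1 => 1) := by
  have hle : ∀ t, ∑ i, max (x i - t) 0 ≤ ∑ i, max (y i - t) 0 := by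
    intro t
    simp only [h]
    have hconv : ConvexOn ℝ Set.univ fun v : ℝ => max (v - t) 0 :=
      ((convexOn_id convex_univ).sub (concaveOn_const t convex_univ)).sup
        (convexOn_const 0 convex_univ)
    exact hy.card_mul_le hconv fun i => Set.mem_univ _
  exact Maj.tensor_trans (fun _ => zero_le_one) ⟨rfl, fun _ => le_rfl⟩ (hx.2.trans hy.2.symm) hle

end Main

/-- ε-approximate catalytic majorization is equivalent to the nonstrict
decrease of the whole family of Rényi entropies. -/
theorem approx_catalytic_majorization_iff
    (d : ℕ) (p q : Fin d → ℝ) (hp : IsProbVec p) (hq : IsProbVec q) :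
    (∀ ε : ℝ, 0 < ε → ∃ p' : Fin d → ℝ, IsProbVec p' ∧ (∑ i, |p' i - p i| < ε) ∧
      ∃ m : ℕ, 1 ≤ m ∧ ∃ r : Fin m → ℝ, IsProbVec r ∧ Maj (tensor p' r) (tensor q r))
    ↔ ((∀ α : ℝ, 0 < α → α < 1 → Aalpha d α q ≤ Aalpha d α p) ∧
       (∏ i, q i ≤ ∏ i, p i) ∧
       (∀ α : ℝ, α < 0 → Aalpha d α q ≤ Aalpha d α p) ∧
       (∀ α : ℝ, 1 < α → Aalpha d α p ≤ Aalpha d α q) ∧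
       shannon q ≤ shannon p) := by
  rw [← renyiLE_iff hp hq]
  constructor
  · intro h
    choose u hu hup m _ r hr hmaj using fun n : ℕ => h (1 / ((n : ℝ) + 1)) (by positivity)
    refine RenyiLE.of_tendsto (fun n => (hmaj n).renyiLE (hu n) hq (hr n)) ?_
    refine tendsto_pi_nhds.2 fun i => tendsto_iff_dist_tendsto_zero.2 ?_
    refine squeeze_zero (fun n => dist_nonneg) (fun n => ?_)
      (tendsto_one_div_add_atTop_nhds_zero_nat (𝕜 := ℝ))
    exact (Finset.single_le_sum (f := fun i => |u n i - p i|) (fun i _ => abs_nonneg _)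
      (mem_univ i)).trans (hup n).le
  · intro h ε hε
    by_cases hne : ∃ i, p i ≠ 1 / Fintype.card (Fin d)
    · obtain ⟨η, hη, h0, h1⟩ := (((tendsto_mixUniform p).eventually
        (sum_abs_sub_eventually_lt p hε).eventually_nhds).and
          (Ioo_mem_nhdsGT one_pos)).exists
      obtain ⟨z, hz, hzp, hcat⟩ := (h.strictRenyi_mixUniform hp hq hne h0 h1).exists_near
        (hp.isProbVec_mixUniform h0.le h1.le) hq hη
      exact ⟨z, hzp, hz, hcat⟩
    · push Not at hne
      exact ⟨p, hp, by simpa using hε, 1, le_rfl, fun _ => 1, ⟨fun _ => zero_le_one, by simp⟩,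
        maj_of_eq_uniform hp hq hne⟩
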